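/- arXiv:2604.02067 — 3 statements merged into one kernel-verified Lean document; each statement's English description precedes it below -/
import Mathlib

section
/- Let n = 3, q a power of an odd prime, f = a₁X₁²+a₂X₂²+a₃X₃² with a_i ∈ 𝔽_q^×. Then for all P ≥ 1, N(P) = ((q²−1)/(2q))·P·q^P + q^P if P is even, and N(P) = ((q²−1)/(2q))·P·q^P + ((q²+1)/(2q))·q^P if P is odd. -/
open Polynomial

/-- `N(P)`: the number of `x ∈ 𝔽_q[t]^n` with all `deg x_i < P` and
`a₁x₁² + ⋯ + a_nx_n² = 0`. -/
noncomputable def diagCount {Fq : Type} [Field Fq] {n : ℕ} (a : Fin n → Fq) (P : ℕ) : ℕ :=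
  Nat.card {x : Fin n → Polynomial Fq //
    (∀ i, (x i).degree < (P : WithBot ℕ)) ∧ ∑ i, Polynomial.C (a i) * x i ^ 2 = 0}

namespace Polynomial

section ScaledPair

variable (F : Type) [Field F]

/-- Coprime pairs `(u, v)` with `u` monic and `e * deg u, e * deg v < P`. -/
abbrev PrimitivePair (e P : ℕ) : Type :=
  {p : F[X] × F[X] // p.1.Monic ∧ IsCoprime p.1 p.2 ∧
    e * p.1.natDegree < P ∧ e * p.2.natDegree < P}

/-- Nonzero multiples `g` of primitive pairs `(u, v)`, where the pair has weight `e`: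
`deg g + e * deg u, deg g + e * deg v < P`. -/
abbrev ScaledPair (e P : ℕ) : Type :=
  {p : F[X] × F[X] × F[X] // p.1 ≠ 0 ∧ p.2.1.Monic ∧ IsCoprime p.2.1 p.2.2 ∧
    p.1.natDegree + e * p.2.1.natDegree < P ∧ p.1.natDegree + e * p.2.2.natDegree < P}

variable {F}

theorem natDegree_X_mul_add_C {g : F[X]} (hg : g ≠ 0) (c : F) :
    (X * g + C c).natDegree = g.natDegree + 1 := by
  rw [natDegree_add_C, natDegree_X_mul hg]

/-- Split off the constant term of `g`. -/
theorem bijective_scaledPair_succ (e P : ℕ) :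
    Function.Bijective (Sum.elim
      (fun p : F × ScaledPair F e P ↦ (⟨(X * p.2.1.1 + C p.1, p.2.1.2), by
        obtain ⟨c, ⟨g, u, v⟩, hg, hu, huv, h1, h2⟩ := p
        have hd := natDegree_X_mul_add_C hg c
        dsimp only at hd h1 h2 ⊢
        refine ⟨?_, hu, huv, by omega, by omega⟩
        intro h
        rw [h, natDegree_zero] at hd
        omega⟩ : ScaledPair F e (P + 1)))
      (fun p : Fˣ × PrimitivePair F e (P + 1) ↦ (⟨(C (p.1 : F), p.2.1), by
        obtain ⟨c, ⟨u, v⟩, hu, huv, h1, h2⟩ := p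
        dsimp only at hu huv h1 h2 ⊢
        rw [natDegree_C, zero_add, zero_add]
        exact ⟨C_ne_zero.mpr c.ne_zero, hu, huv, h1, h2⟩⟩ : ScaledPair F e (P + 1)))) := by
  constructor
  · rintro (⟨c, ⟨g, u, v⟩, hg, hu, huv, h1, h2⟩ | ⟨c, ⟨u, v⟩, hu, huv, h1, h2⟩)
      (⟨c', ⟨g', u', v'⟩, hg', hu', huv', h1', h2'⟩ | ⟨c', ⟨u', v'⟩, hu', huv', h1', h2'⟩) h
    · simp only [Sum.elim_inl, Subtype.mk.injEq, Prod.mk.injEq] at h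
      obtain ⟨h, rfl, rfl⟩ := h
      have hc : c = c' := by simpa using congrArg (coeff · 0) h
      subst hc
      have : g = g' := by simpa using h
      subst this
      rfl
    · simp only [Sum.elim_inl, Sum.elim_inr, Subtype.mk.injEq, Prod.mk.injEq] at h
      have := natDegree_X_mul_add_C hg c
      rw [h.1, natDegree_C] at this
      omega
    · simp only [Sum.elim_inl, Sum.elim_inr, Subtype.mk.injEq, Prod.mk.injEq] at h
      have := natDegree_X_mul_add_C hg' c'
      rw [← h.1, natDegree_C] at this
      omega
    · simp only [Sum.elim_inr, Subtype.mk.injEq, Prod.mk.injEq, C_inj, Units.val_inj] at h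
      obtain ⟨rfl, rfl, rfl⟩ := h
      rfl
  · rintro ⟨⟨g, u, v⟩, hg, hu, huv, h1, h2⟩
    dsimp only at hg hu huv h1 h2
    have hdecomp := X_mul_divX_add g
    by_cases hd : divX g = 0
    · rw [hd, mul_zero, zero_add] at hdecomp
      have hc : g.coeff 0 ≠ 0 := fun h ↦ hg (by rw [← hdecomp, h, C_0])
      refine ⟨Sum.inr ⟨Units.mk0 _ hc, ⟨(u, v), hu, huv, ?_, ?_⟩⟩, ?_⟩
      · dsimp only; omega
      · dsimp only; omega
      simp [hdecomp]
    · have hn := natDegree_X_mul_add_C hd (g.coeff 0)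
      rw [hdecomp] at hn
      refine ⟨Sum.inl ⟨g.coeff 0, ⟨(divX g, u, v), hd, hu, huv, ?_, ?_⟩⟩, ?_⟩
      · dsimp only; omega
      · dsimp only; omega
      · simp [hdecomp]

theorem eq_of_scaledPair_eq {g u v g' u' v' : F[X]} (hg : g ≠ 0) (hu : u.Monic)
    (huv : IsCoprime u v) (hu' : u'.Monic) (huv' : IsCoprime u' v')
    (h1 : g * u = g' * u') (h2 : g * v = g' * v') : g = g' ∧ u = u' ∧ v = v' := by
  have hlc : g.leadingCoeff = g'.leadingCoeff := by
    simpa [hu.leadingCoeff, hu'.leadingCoeff] using congrArg leadingCoeff h1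
  have hdvd : g ∣ g' := by
    obtain ⟨r, s, hrs⟩ := huv'
    exact ⟨r * u + s * v, by linear_combination (-g') * hrs - r * h1 - s * h2⟩
  have hdvd' : g' ∣ g := by
    obtain ⟨r, s, hrs⟩ := huv
    exact ⟨r * u' + s * v', by linear_combination (-g) * hrs + r * h1 + s * h2⟩
  have hgg : g = g' := by
    obtain ⟨w, hw⟩ := associated_of_dvd_dvd hdvd hdvd'
    obtain ⟨c, -, hc⟩ := isUnit_iff.mp w.isUnit
    rw [← hc] at hw
    have : c = 1 := by
      have h := congrArg leadingCoeff hw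
      rw [leadingCoeff_mul, leadingCoeff_C, ← hlc] at h
      exact mul_left_cancel₀ (leadingCoeff_ne_zero.mpr hg) (by rw [h, mul_one])
    rw [← hw, this, C_1, mul_one]
  subst hgg
  exact ⟨rfl, mul_left_cancel₀ hg h1, mul_left_cancel₀ hg h2⟩

theorem exists_scaledPair_eq {x z : F[X]} (hx : x ≠ 0) :
    ∃ g u v : F[X], g ≠ 0 ∧ u.Monic ∧ IsCoprime u v ∧ x = g * u ∧ z = g * v := by
  classical
  obtain ⟨u, v, hc, hxu, hzv⟩ : ∃ u v, IsCoprime u v ∧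
      x = EuclideanDomain.gcd x z * u ∧ z = EuclideanDomain.gcd x z * v := by
    have hd : EuclideanDomain.gcd x z ≠ 0 := fun h ↦ hx (EuclideanDomain.gcd_eq_zero_iff.mp h).1
    obtain ⟨u, hu⟩ := EuclideanDomain.gcd_dvd_left x z
    obtain ⟨v, hv⟩ := EuclideanDomain.gcd_dvd_right x z
    refine ⟨u, v, ⟨EuclideanDomain.gcdA x z, EuclideanDomain.gcdB x z, ?_⟩, hu, hv⟩
    have hb := EuclideanDomain.gcd_eq_gcd_ab x z
    generalize EuclideanDomain.gcd x z = d at *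
    apply mul_left_cancel₀ hd
    linear_combination -hb - EuclideanDomain.gcdA x z * hu - EuclideanDomain.gcdB x z * hv
  generalize EuclideanDomain.gcd x z = d at *
  have hd : d ≠ 0 := by rintro rfl; simp at hxu; exact hx hxu
  have hu0 : u ≠ 0 := by rintro rfl; simp at hxu; exact hx hxu
  have hl : u.leadingCoeff ≠ 0 := leadingCoeff_ne_zero.mpr hu0
  have hinv : C u.leadingCoeff * C u.leadingCoeff⁻¹ = 1 := by
    rw [← C_mul, mul_inv_cancel₀ hl, C_1]
  have hunit : IsUnit (C u.leadingCoeff⁻¹) :=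
    isUnit_C.mpr (isUnit_iff_ne_zero.mpr (inv_ne_zero hl))
  refine ⟨d * C u.leadingCoeff, u * C u.leadingCoeff⁻¹, v * C u.leadingCoeff⁻¹,
    mul_ne_zero hd (C_ne_zero.mpr hl), monic_mul_leadingCoeff_inv hu0, ?_, ?_, ?_⟩
  · exact (isCoprime_mul_unit_right hunit u v).mpr hc
  · linear_combination hxu - d * u * hinv
  · linear_combination hzv - d * v * hinv

theorem mem_degreeLT_of_natDegree_lt {p : F[X]} {n : ℕ} (h : p.natDegree < n) :
    p ∈ degreeLT F n :=
  mem_degreeLT.mpr (degree_le_natDegree.trans_lt (by exact_mod_cast h))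

theorem natDegree_lt_of_mem_degreeLT {p : F[X]} {n : ℕ} (hp : p ≠ 0) (h : p ∈ degreeLT F n) :
    p.natDegree < n :=
  (natDegree_lt_iff_degree_lt hp).mpr (mem_degreeLT.mp h)

theorem bijective_scaledPair_one (m : ℕ) :
    Function.Bijective (fun p : ScaledPair F 1 m ↦
      ((⟨⟨p.1.1 * p.1.2.1, mem_degreeLT_of_natDegree_lt (by
          have := p.2.2.2.2.1
          have := natDegree_mul_le (p := p.1.1) (q := p.1.2.1)
          omega)⟩,
        fun h ↦ mul_ne_zero p.2.1 p.2.2.1.ne_zero (congrArg Subtype.val h)⟩,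
       ⟨p.1.1 * p.1.2.2, mem_degreeLT_of_natDegree_lt (by
          have := p.2.2.2.2.2
          have := natDegree_mul_le (p := p.1.1) (q := p.1.2.2)
          omega)⟩) : {x : degreeLT F m // x ≠ 0} × degreeLT F m)) := by
  constructor
  · rintro ⟨⟨g, u, v⟩, hg, hu, huv, h1, h2⟩ ⟨⟨g', u', v'⟩, hg', hu', huv', h1', h2'⟩ h
    simp only [Prod.mk.injEq, Subtype.mk.injEq] at h
    obtain ⟨rfl, rfl, rfl⟩ := eq_of_scaledPair_eq hg hu huv hu' huv' h.1 h.2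
    rfl
  · rintro ⟨⟨⟨x, hx⟩, hx0⟩, ⟨z, hz⟩⟩
    replace hx0 : x ≠ 0 := fun h ↦ hx0 (Subtype.ext h)
    obtain ⟨g, u, v, hg, hu, huv, rfl, rfl⟩ := exists_scaledPair_eq (z := z) hx0
    have h1 := natDegree_lt_of_mem_degreeLT hx0 hx
    rw [natDegree_mul hg hu.ne_zero] at h1
    refine ⟨⟨(g, u, v), hg, hu, huv, by dsimp only; omega, ?_⟩, rfl⟩
    dsimp only
    by_cases hv : v = 0
    · simp only [hv, natDegree_zero]; omega
    · have h2 := natDegree_lt_of_mem_degreeLT (mul_ne_zero hg hv) hz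
      rw [natDegree_mul hg hv] at h2
      omega

variable (F) in
/-- Solutions of `x * y = z ^ 2` of degree less than `P`. -/
abbrev ConePoint (P : ℕ) : Type :=
  {p : degreeLT F P × degreeLT F P × degreeLT F P //
    (p.1 : F[X]) * p.2.1 = (p.2.2 : F[X]) ^ 2}

theorem bijective_conePoint (P : ℕ) :
    Function.Bijective (Sum.elim
      (fun y : degreeLT F P ↦ (⟨(0, y, 0), by simp⟩ : ConePoint F P))
      (fun p : ScaledPair F 2 P ↦ (⟨
        (⟨p.1.1 * p.1.2.1 ^ 2, mem_degreeLT_of_natDegree_lt (by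
          have := p.2.2.2.2.1
          have := natDegree_mul_le (p := p.1.1) (q := p.1.2.1 ^ 2)
          rw [natDegree_pow] at this
          omega)⟩,
        ⟨p.1.1 * p.1.2.2 ^ 2, mem_degreeLT_of_natDegree_lt (by
          have := p.2.2.2.2.2
          have := natDegree_mul_le (p := p.1.1) (q := p.1.2.2 ^ 2)
          rw [natDegree_pow] at this
          omega)⟩,
        ⟨p.1.1 * p.1.2.1 * p.1.2.2, mem_degreeLT_of_natDegree_lt (by
          have := p.2.2.2.2.1
          have := p.2.2.2.2.2
          have := natDegree_mul_le (p := p.1.1 * p.1.2.1) (q := p.1.2.2)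
          have := natDegree_mul_le (p := p.1.1) (q := p.1.2.1)
          omega)⟩), by dsimp only; ring⟩ : ConePoint F P))) := by
  constructor
  · rintro (y | ⟨⟨g, u, v⟩, hg, hu, huv, h1, h2⟩)
      (y' | ⟨⟨g', u', v'⟩, hg', hu', huv', h1', h2'⟩) h
    · simpa using h
    · simp only [Sum.elim_inl, Sum.elim_inr, Subtype.mk.injEq, Prod.mk.injEq] at h
      exact absurd (congrArg Subtype.val h.1).symm (mul_ne_zero hg' (pow_ne_zero 2 hu'.ne_zero))
    · simp only [Sum.elim_inl, Sum.elim_inr, Subtype.mk.injEq, Prod.mk.injEq] at h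
      exact absurd (congrArg Subtype.val h.1) (mul_ne_zero hg (pow_ne_zero 2 hu.ne_zero))
    · simp only [Sum.elim_inr, Subtype.mk.injEq, Prod.mk.injEq] at h
      obtain ⟨ha, -, hb⟩ := h
      obtain ⟨hgu, rfl, rfl⟩ := eq_of_scaledPair_eq (g := g * u) (g' := g' * u')
        (mul_ne_zero hg hu.ne_zero) hu huv hu' huv' (by linear_combination ha) hb
      obtain rfl := mul_right_cancel₀ hu.ne_zero hgu
      rfl
  · rintro ⟨⟨⟨x, hx⟩, ⟨y, hy⟩, ⟨z, hz⟩⟩, h⟩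
    dsimp only at h
    by_cases hx0 : x = 0
    · subst hx0
      have hz0 : z = 0 := by simpa using h.symm
      subst hz0
      exact ⟨Sum.inl ⟨y, hy⟩, rfl⟩
    · obtain ⟨k, u, v, hk, hu, huv, rfl, rfl⟩ := exists_scaledPair_eq (z := z) hx0
      have h' : u * y = k * v ^ 2 := mul_left_cancel₀ hk (by linear_combination h)
      obtain ⟨g, rfl⟩ : u ∣ k := (huv.pow_right (n := 2)).dvd_of_dvd_mul_right ⟨y, h'.symm⟩
      have hg : g ≠ 0 := right_ne_zero_of_mul hk
      obtain rfl : y = g * v ^ 2 := mul_left_cancel₀ hu.ne_zero (by linear_combination h')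
      have h1 := natDegree_lt_of_mem_degreeLT hx0 hx
      rw [natDegree_mul hk hu.ne_zero, natDegree_mul hu.ne_zero hg] at h1
      refine ⟨Sum.inr ⟨(g, u, v), hg, hu, huv, by dsimp only; omega, ?_⟩, ?_⟩
      · dsimp only
        by_cases hv : v = 0
        · simp only [hv, natDegree_zero]; omega
        · have h2 := natDegree_lt_of_mem_degreeLT (mul_ne_zero hg (pow_ne_zero 2 hv)) hy
          rw [natDegree_mul hg (pow_ne_zero 2 hv), natDegree_pow] at h2
          omega
      · simp only [Sum.elim_inr, Subtype.mk.injEq, Prod.mk.injEq]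
        exact ⟨by ring, trivial, by ring⟩

theorem finite_primitivePair {e P : ℕ} (h : Finite (ScaledPair F e (P + 1))) :
    Finite (PrimitivePair F e (P + 1)) :=
  Finite.of_injective _ (((bijective_scaledPair_succ e P).1.comp Sum.inr_injective).comp
    (Prod.mk_right_injective (1 : Fˣ)))

theorem card_scaledPair_two_zero : Nat.card (ScaledPair F 2 0) = 0 := by
  have : IsEmpty (ScaledPair F 2 0) := ⟨fun p ↦ Nat.not_lt_zero _ p.2.2.2.2.1⟩
  exact Nat.card_of_isEmpty

end ScaledPair

section Card

variable {F : Type} [Field F] [Fintype F]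

instance (n : ℕ) : Finite (degreeLT F n) :=
  Finite.of_equiv _ (degreeLTEquiv F n).symm.toEquiv

theorem card_degreeLT (n : ℕ) : Nat.card (degreeLT F n) = Fintype.card F ^ n := by
  rw [Nat.card_congr (degreeLTEquiv F n).toEquiv]
  simp

theorem card_ne_zero_degreeLT (n : ℕ) :
    Nat.card {x : degreeLT F n // x ≠ 0} = Fintype.card F ^ n - 1 := by
  classical
  have := Fintype.ofFinite (degreeLT F n)
  rw [Nat.card_eq_fintype_card, Fintype.card_subtype_compl, Fintype.card_subtype_eq,
    ← Nat.card_eq_fintype_card, card_degreeLT]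

theorem finite_scaledPair_one (m : ℕ) : Finite (ScaledPair F 1 m) :=
  Finite.of_injective _ (bijective_scaledPair_one m).1

theorem finite_scaledPair_two (P : ℕ) : Finite (ScaledPair F 2 P) :=
  Finite.of_injective _ ((bijective_conePoint P).1.comp Sum.inr_injective)

theorem card_scaledPair_succ {e : ℕ} (h : ∀ P, Finite (ScaledPair F e P)) (P : ℕ) :
    Nat.card (ScaledPair F e (P + 1)) = Fintype.card F * Nat.card (ScaledPair F e P) +
      (Fintype.card F - 1) * Nat.card (PrimitivePair F e (P + 1)) := by
  classical
  have := h P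
  have := finite_primitivePair (h (P + 1))
  rw [← Nat.card_eq_of_bijective _ (bijective_scaledPair_succ e P), Nat.card_sum, Nat.card_prod,
    Nat.card_prod, Nat.card_eq_fintype_card (α := F), Nat.card_eq_fintype_card (α := Fˣ),
    Fintype.card_units]

theorem card_scaledPair_one (m : ℕ) :
    Nat.card (ScaledPair F 1 m) = (Fintype.card F ^ m - 1) * Fintype.card F ^ m := by
  rw [Nat.card_eq_of_bijective _ (bijective_scaledPair_one m), Nat.card_prod,
    card_ne_zero_degreeLT, card_degreeLT]

theorem card_primitivePair_one (m : ℕ) :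
    Nat.card (PrimitivePair F 1 (m + 1)) = Fintype.card F ^ (2 * m + 1) := by
  have h := card_scaledPair_succ (F := F) finite_scaledPair_one m
  rw [card_scaledPair_one, card_scaledPair_one] at h
  have hq : 1 < Fintype.card F := Fintype.one_lt_card
  generalize Fintype.card F = q at *
  zify [Nat.one_le_pow _ _ (zero_lt_one.trans hq), hq.le] at h ⊢
  have hq' : (q : ℤ) - 1 ≠ 0 := by
    have : (1 : ℤ) < q := by exact_mod_cast hq
    omega
  apply mul_left_cancel₀ hq'
  linear_combination -h

theorem card_primitivePair_two (P : ℕ) :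
    Nat.card (PrimitivePair F 2 (P + 1)) = Fintype.card F ^ (2 * (P / 2) + 1) := by
  rw [← card_primitivePair_one]
  refine Nat.card_congr (Equiv.subtypeEquivRight fun p ↦ ?_)
  refine and_congr_right' (and_congr_right' (and_congr ?_ ?_)) <;> omega

theorem card_conePoint_eq (P : ℕ) :
    Nat.card (ConePoint F P) = Fintype.card F ^ P + Nat.card (ScaledPair F 2 P) := by
  have := finite_scaledPair_two (F := F) P
  rw [← Nat.card_eq_of_bijective _ (bijective_conePoint P), Nat.card_sum, card_degreeLT]

theorem card_scaledPair_two (P : ℕ) :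
    (Nat.card (ScaledPair F 2 P) : ℚ) =
      ((Fintype.card F : ℚ) ^ 2 - 1) / (2 * (Fintype.card F : ℚ)) * P *
          (Fintype.card F : ℚ) ^ P +
        (if Even P then 0
         else ((Fintype.card F : ℚ) - 1) ^ 2 / (2 * (Fintype.card F : ℚ)) *
           (Fintype.card F : ℚ) ^ P) := by
  have hq : 1 < Fintype.card F := Fintype.one_lt_card
  have hq0 : (Fintype.card F : ℚ) ≠ 0 := by positivity
  induction P with
  | zero => simp [card_scaledPair_two_zero]
  | succ P ih =>
    rw [card_scaledPair_succ finite_scaledPair_two, card_primitivePair_two]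
    push_cast [hq.le]
    rw [ih]
    generalize (Fintype.card F : ℚ) = q at *
    obtain ⟨k, rfl | rfl⟩ := P.even_or_odd'
    · have h1 : Even (2 * k) := even_two_mul k
      have h2 : ¬ Even (2 * k + 1) := by simp
      rw [if_pos h1, if_neg h2, Nat.mul_div_cancel_left _ two_pos]
      push_cast
      field_simp
      ring
    · have h1 : ¬ Even (2 * k + 1) := by simp
      have h2 : Even (2 * k + 1 + 1) := ⟨k + 1, by ring⟩
      rw [if_neg h1, if_pos h2, show (2 * k + 1) / 2 = k by omega]
      push_cast
      field_simp
      ring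

end Card

section Diagonal

variable {F : Type} [Field F]

theorem C_mul_mem_degreeLT {n : ℕ} {p : F[X]} (c : F) (hp : p ∈ degreeLT F n) :
    C c * p ∈ degreeLT F n := by
  rw [← smul_eq_C_mul]
  exact Submodule.smul_mem _ c hp

/-- A nondegenerate diagonal ternary form that is isotropic, `a₁b² + a₂c² + a₃ = 0`, is
equivalent to a multiple of `xy - z²`. -/
noncomputable def diagonalEquivConePoint (h2 : (2 : F) ≠ 0) (a : Fin 3 → F)
    (ha : ∀ i, a i ≠ 0) (b c : F) (hbc : a 0 * b ^ 2 + a 1 * c ^ 2 + a 2 = 0) (P : ℕ) :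
    {x : Fin 3 → F[X] // (∀ i, (x i).degree < (P : WithBot ℕ)) ∧ ∑ i, C (a i) * x i ^ 2 = 0} ≃
      ConePoint F P :=
  have hm : C (a 0) * C (a 1) * C (a 0 * a 1)⁻¹ = 1 := by
    rw [← C_mul, ← C_mul, mul_inv_cancel₀ (mul_ne_zero (ha 0) (ha 1)), C_1]
  have hd : C (a 2) * C (a 2)⁻¹ = 1 := by
    rw [← C_mul, mul_inv_cancel₀ (ha 2), C_1]
  have ht : (2 : F[X]) * C 2⁻¹ = 1 := by
    rw [← C_ofNat, ← C_mul, mul_inv_cancel₀ h2, C_1]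
  have hQ : C (a 0) * C b ^ 2 + C (a 1) * C c ^ 2 + C (a 2) = 0 := by
    simpa using congrArg C hbc
  { toFun := fun x ↦ ⟨
      (⟨x.1 2 + C (a 2)⁻¹ * (C (a 0 * b) * x.1 0 + C (a 1 * c) * x.1 1), by
        have h := fun i ↦ mem_degreeLT.mpr (x.2.1 i)
        exact add_mem (h 2) (C_mul_mem_degreeLT _ (add_mem (C_mul_mem_degreeLT _ (h 0))
          (C_mul_mem_degreeLT _ (h 1))))⟩,
       ⟨C (a 0 * a 1)⁻¹ *
          (x.1 2 - C (a 2)⁻¹ * (C (a 0 * b) * x.1 0 + C (a 1 * c) * x.1 1)), by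
        have h := fun i ↦ mem_degreeLT.mpr (x.2.1 i)
        exact C_mul_mem_degreeLT _ (sub_mem (h 2) (C_mul_mem_degreeLT _
          (add_mem (C_mul_mem_degreeLT _ (h 0)) (C_mul_mem_degreeLT _ (h 1)))))⟩,
       ⟨C (a 2)⁻¹ * (C c * x.1 0 - C b * x.1 1), by
        have h := fun i ↦ mem_degreeLT.mpr (x.2.1 i)
        exact C_mul_mem_degreeLT _ (sub_mem (C_mul_mem_degreeLT _ (h 0))
          (C_mul_mem_degreeLT _ (h 1)))⟩), by
      have h := x.2.2
      rw [Fin.sum_univ_three] at h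
      dsimp only
      generalize C (a 2)⁻¹ = d at *
      generalize C (a 0 * a 1)⁻¹ = m at *
      rw [C_mul, C_mul]
      linear_combination
        -m * d ^ 2 * ((C (a 0) * C b ^ 2 + C (a 1) * C c ^ 2) * h
          - C (a 2) * x.1 2 ^ 2 * hQ)
        + d ^ 2 * (C c * x.1 0 - C b * x.1 1) ^ 2 * hm
        - m * x.1 2 ^ 2 * (1 + d * C (a 2)) * hd⟩
    invFun := fun p ↦ ⟨
      ![C b * (C 2⁻¹ * (C (a 0 * a 1) * (p.1.2.1 : F[X]) - (p.1.1 : F[X])))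
          - C (a 1 * c) * (p.1.2.2 : F[X]),
        C c * (C 2⁻¹ * (C (a 0 * a 1) * (p.1.2.1 : F[X]) - (p.1.1 : F[X])))
          + C (a 0 * b) * (p.1.2.2 : F[X]),
        C 2⁻¹ * (C (a 0 * a 1) * (p.1.2.1 : F[X]) + (p.1.1 : F[X]))], by
      obtain ⟨⟨⟨x, hx⟩, ⟨y, hy⟩, ⟨z, hz⟩⟩, h⟩ := p
      dsimp only at h ⊢
      have hX := C_mul_mem_degreeLT 2⁻¹ (sub_mem (C_mul_mem_degreeLT (a 0 * a 1) hy) hx)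
      have hY := C_mul_mem_degreeLT 2⁻¹ (add_mem (C_mul_mem_degreeLT (a 0 * a 1) hy) hx)
      constructor
      · intro i
        rw [← mem_degreeLT]
        fin_cases i
        · exact sub_mem (C_mul_mem_degreeLT _ hX) (C_mul_mem_degreeLT _ hz)
        · exact add_mem (C_mul_mem_degreeLT _ hX) (C_mul_mem_degreeLT _ hz)
        · exact hY
      · rw [Fin.sum_univ_three]
        generalize C (2 : F)⁻¹ = t at *
        simp only [Matrix.cons_val, C_mul]
        linear_combination
          ((t * (C (a 0) * C (a 1) * y - x)) ^ 2 + C (a 0) * C (a 1) * z ^ 2) * hQ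
          + C (a 2) * C (a 0) * C (a 1) * h
          + C (a 2) * C (a 0) * C (a 1) * x * y * (2 * t + 1) * ht⟩
    left_inv := by
      rintro ⟨x, hx, h⟩
      apply Subtype.ext
      dsimp only
      generalize C (2 : F)⁻¹ = t at *
      generalize C (a 2)⁻¹ = d at *
      generalize C (a 0 * a 1)⁻¹ = m at *
      simp only [C_mul]
      set S := C (a 0) * C b * x 0 + C (a 1) * C c * x 1 with hS
      funext i
      fin_cases i
      · simp only [Fin.zero_eta, Matrix.cons_val]
        linear_combination C b * (-d * S * ht + t * (x 2 - d * S) * hm) - d * x 0 * hQ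
          + x 0 * hd - d * C b * hS
      · simp only [Fin.mk_one, Matrix.cons_val]
        linear_combination C c * (-d * S * ht + t * (x 2 - d * S) * hm) - d * x 1 * hQ
          + x 1 * hd - d * C c * hS
      · simp only [Fin.reduceFinMk, Matrix.cons_val]
        linear_combination x 2 * ht + t * (x 2 - d * S) * hm
    right_inv := by
      rintro ⟨⟨⟨x, hx⟩, ⟨y, hy⟩, ⟨z, hz⟩⟩, h⟩
      simp only [Subtype.mk.injEq, Prod.mk.injEq]
      generalize C (2 : F)⁻¹ = t at *
      generalize C (a 2)⁻¹ = d at *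
      generalize C (a 0 * a 1)⁻¹ = m at *
      simp only [Matrix.cons_val, C_mul]
      set w := t * (C (a 0) * C (a 1) * y - x) with hw
      refine ⟨?_, ?_, ?_⟩
      · linear_combination x * ht + d * w * hQ - w * hd - hw
      · linear_combination 2 * t * y * hm + y * ht - m * d * w * hQ + m * w * hd + m * hw
      · linear_combination -d * z * hQ + z * hd }

end Diagonal

end Polynomial

/-- For `n = 3` and `q` a power of an odd prime, for all `P ≥ 1`:
`N(P) = ((q²-1)/(2q))·P·q^P + q^P` if `P` is even, and
`N(P) = ((q²-1)/(2q))·P·q^P + ((q²+1)/(2q))·q^P` if `P` is odd. -/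
theorem count_three (Fq : Type) [Field Fq] [Fintype Fq] (hchar : ringChar Fq ≠ 2)
    (a : Fin 3 → Fq) (ha : ∀ i, a i ≠ 0)
    (P : ℕ) (hP : 1 ≤ P) :
    (diagCount a P : ℚ) =
      ((Fintype.card Fq : ℚ) ^ 2 - 1) / (2 * (Fintype.card Fq : ℚ)) * P *
          (Fintype.card Fq : ℚ) ^ P +
        (if Even P then (Fintype.card Fq : ℚ) ^ P
         else ((Fintype.card Fq : ℚ) ^ 2 + 1) / (2 * (Fintype.card Fq : ℚ)) *
           (Fintype.card Fq : ℚ) ^ P) := by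
  classical
  have h2 : (2 : Fq) ≠ 0 := Ring.two_ne_zero hchar
  obtain ⟨b, c, hbc⟩ : ∃ b c : Fq, a 0 * b ^ 2 + a 1 * c ^ 2 + a 2 = 0 := by
    obtain ⟨b, c, h⟩ := FiniteField.exists_root_sum_quadratic
      (f := C (a 0) * X ^ 2) (g := C (a 1) * X ^ 2 + C (a 2))
      (by rw [degree_C_mul_X_pow 2 (ha 0)]; rfl)
      (by rw [degree_add_C (by rw [degree_C_mul_X_pow 2 (ha 1)]; norm_num),
            degree_C_mul_X_pow 2 (ha 1)]; rfl)
      (FiniteField.odd_card_of_char_ne_two hchar)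
    exact ⟨b, c, by simpa [add_assoc] using h⟩
  rw [diagCount, Nat.card_congr (diagonalEquivConePoint h2 a ha b c hbc P), card_conePoint_eq]
  have hq0 : (Fintype.card Fq : ℚ) ≠ 0 := by exact_mod_cast Fintype.card_ne_zero
  push_cast
  rw [card_scaledPair_two]
  split_ifs
  · ring
  · field_simp
    ring
end

section
/- Let X ⊂ ℙ³ be the quadric surface over 𝔽_q (q odd) defined by a diagonal form f = a₁X₁²+⋯+a₄X₄² with a₁a₂a₃a₄ not a square in 𝔽_q^×. Then the number of morphisms ℙ¹ → X over 𝔽_q of degree exactly P equals (q⁴−1)/q² · q^{2P} if P is even, and equals 0 if P is odd. -/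
open Polynomial

/-- The number of morphisms `ℙ¹ → X` of degree exactly `P` defined over `𝔽_q`, where
`X ⊂ ℙ^{n-1}` is the quadric cut out by the diagonal form; it equals
`(N(P+1) - (q+1)N(P) + qN(P-1))/(q-1)`. -/
noncomputable def morCount {Fq : Type} [Field Fq] [Fintype Fq] {n : ℕ}
    (a : Fin n → Fq) (P : ℕ) : ℚ :=
  ((diagCount a (P + 1) : ℚ) - ((Fintype.card Fq : ℚ) + 1) * (diagCount a P : ℚ) +
      (Fintype.card Fq : ℚ) * (diagCount a (P - 1) : ℚ)) / ((Fintype.card Fq : ℚ) - 1)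

theorem finite_degree_lt (L : Type*) [Field L] [Finite L] (n : ℕ) :
    {p : L[X] | p.degree < n}.Finite := by
  have : Finite (degreeLT L n) := Finite.of_equiv _ (degreeLTEquiv L n).symm.toEquiv
  exact (Set.toFinite (degreeLT L n : Set L[X])).subset fun p hp => mem_degreeLT.2 hp

theorem ncard_degree_lt (L : Type*) [Field L] [Finite L] (n : ℕ) :
    {p : L[X] | p.degree < n}.ncard = Nat.card L ^ n := by
  have h : {p : L[X] | p.degree < n} = (degreeLT L n : Set L[X]) := by
    ext p; exact mem_degreeLT.symm
  rw [h, ← Nat.card_coe_set_eq]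
  exact (Nat.card_congr (degreeLTEquiv L n).toEquiv).trans (by simp [Nat.card_fun])

theorem ncard_eq_card_mul_ncard {α β G : Type*} {T : Set α} {S : Set β} (hT : T.Finite)
    (f : α → β) (hf : Set.MapsTo f T S)
    (hfib : ∀ s ∈ S, ∃ φ : G → α, φ.Injective ∧ Set.range φ = {t ∈ T | f t = s})
    [Nonempty G] :
    T.ncard = Nat.card G * S.ncard := by
  classical
  have hS : S.Finite := (hT.image f).subset fun s hs => by
    obtain ⟨φ, -, h⟩ := hfib s hs
    have : φ (Classical.arbitrary G) ∈ {t ∈ T | f t = s} := h ▸ Set.mem_range_self _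
    exact ⟨_, this.1, this.2⟩
  rw [Set.ncard_eq_toFinset_card T hT, Set.ncard_eq_toFinset_card S hS,
    Finset.card_eq_sum_card_fiberwise (f := f) (t := hS.toFinset)
      (by simpa [Set.MapsTo] using hf), mul_comm]
  refine Finset.sum_const_nat fun s hs => ?_
  obtain ⟨φ, hφ, h⟩ := hfib s (by simpa using hs)
  rw [← Set.ncard_range_of_injective hφ, h, ← Set.ncard_coe_finset]
  congr 1
  ext; simp

theorem withBot_add_eq_natCast {a b : WithBot ℕ} {n : ℕ} (h : a + b = n) :
    ∃ i j : ℕ, a = i ∧ b = j ∧ i + j = n := by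
  obtain ⟨i, j, hi, hj, hij⟩ := WithBot.add_eq_coe.1 h
  exact ⟨i, j, hi.symm, hj.symm, hij⟩

theorem degree_mul_X_add_C {R : Type*} [Field R] {k : R[X]} (hk : k ≠ 0) (c : R) :
    (k * X + C c).degree = k.degree + 1 := by
  rw [degree_add_C, degree_mul_X]
  rw [degree_mul_X, degree_eq_natDegree hk]
  exact_mod_cast Nat.succ_pos _

theorem finite_degree_add_eq {L α : Type*} [Field L] [Finite L] (w : α → WithBot ℕ)
    (hw : ∀ n : ℕ, {v | w v < n}.Finite) (P : ℕ) :
    {t : L[X] × α | t.1.degree + w t.2 = P}.Finite := by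
  refine ((finite_degree_lt L (P + 1)).prod (hw (P + 1))).subset fun t ht => ?_
  simp only [Set.mem_ofPred_eq, Set.mem_prod] at ht ⊢
  obtain ⟨i, j, hi, hj, hij⟩ := withBot_add_eq_natCast ht
  rw [hi, hj]
  exact ⟨by exact_mod_cast (by omega : i < P + 1), by exact_mod_cast (by omega : j < P + 1)⟩

theorem ncard_degree_add_succ {L α : Type*} [Field L] [Finite L] (w : α → WithBot ℕ)
    (hw : ∀ n : ℕ, {v | w v < n}.Finite) (P : ℕ) :
    {t : L[X] × α | t.1.degree + w t.2 = (P + 1 : ℕ)}.ncard =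
      Nat.card L * {t : L[X] × α | t.1.degree + w t.2 = P}.ncard +
        (Nat.card L - 1) * {v | w v = (P + 1 : ℕ)}.ncard := by
  have hfin : ∀ n : ℕ, {v | w v = n}.Finite := fun n =>
    (hw (n + 1)).subset fun v (hv : w v = n) => by
      simp only [Set.mem_ofPred_eq, hv]; exact_mod_cast n.lt_succ_self
  have hTfin := finite_degree_add_eq (L := L) w hw P
  let f : L × L[X] × α → L[X] × α := fun s => (s.2.1 * X + C s.1, s.2.2)
  let g : Lˣ × α → L[X] × α := fun s => (C (s.1 : L), s.2)
  have hf : f.Injective := by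
    rintro ⟨c, k, v⟩ ⟨c', k', v'⟩ h
    simp only [f, Prod.mk.injEq] at h
    have h0 := congrArg (fun p => p.coeff 0) h.1
    simp at h0
    have h1 : k = k' := by
      ext n
      simpa using congrArg (fun p => p.coeff (n + 1)) h.1
    simp [h0, h1, h.2]
  have hg : g.Injective := by
    rintro ⟨c, v⟩ ⟨c', v'⟩ h
    simp only [g, Prod.mk.injEq, C_inj, Units.val_inj] at h
    simp [h]
  have hunion : {t : L[X] × α | t.1.degree + w t.2 = (P + 1 : ℕ)} =
      f '' (Set.univ ×ˢ {t : L[X] × α | t.1.degree + w t.2 = P}) ∪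
        g '' (Set.univ ×ˢ {v | w v = (P + 1 : ℕ)}) := by
    ext ⟨k, v⟩
    simp only [f, g, Set.mem_union, Set.mem_image, Set.mem_prod, Set.mem_univ, true_and,
      Set.mem_ofPred_eq, Prod.exists, Prod.mk.injEq]
    constructor
    · intro h
      obtain ⟨i, j, hi, hj, hij⟩ := withBot_add_eq_natCast h
      rcases i with _ | i
      · right
        have h0 := eq_C_of_degree_eq_zero hi
        refine ⟨Units.mk0 (k.coeff 0) fun h => ?_, v, ?_, h0.symm, rfl⟩
        · rw [h0, h] at hi; simp at hi
        · rw [hj]; congr 1; omega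
      · left
        have hk := divX_mul_X_add k
        have hne : divX k ≠ 0 := fun h => by
          rw [h, zero_mul, zero_add] at hk
          have := degree_C_le (a := k.coeff 0)
          rw [hk, hi] at this
          norm_cast at this
        refine ⟨k.coeff 0, divX k, v, ?_, hk, rfl⟩
        have hd := degree_mul_X_add_C hne (k.coeff 0)
        rw [hk, hi, degree_eq_natDegree hne] at hd
        rw [degree_eq_natDegree hne, hj]
        norm_cast at hd ⊢
        omega
    · rintro (⟨c, k, v, h, rfl, rfl⟩ | ⟨u, v, h, rfl, rfl⟩)
      · have hk : k ≠ 0 := by rintro rfl; simp at h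
        rw [degree_mul_X_add_C hk, add_right_comm, h]
        norm_cast
      · rw [degree_C u.ne_zero, zero_add, h]
  have hdisj : Disjoint (f '' (Set.univ ×ˢ {t : L[X] × α | t.1.degree + w t.2 = P}))
        (g '' (Set.univ ×ˢ {v | w v = (P + 1 : ℕ)})) := by
    rw [Set.disjoint_left]
    rintro _ ⟨⟨c, k, v⟩, ⟨-, h⟩, rfl⟩ ⟨⟨u, v'⟩, -, h'⟩
    have hk : k ≠ 0 := by rintro rfl; simp at h
    have hd := degree_mul_X_add_C hk c
    simp only [f, g, Prod.mk.injEq] at h'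
    rw [← h'.1, degree_C u.ne_zero, degree_eq_natDegree hk] at hd
    norm_cast at hd
  rw [hunion, Set.ncard_union_eq hdisj ((Set.finite_univ.prod hTfin).image f)
    ((Set.finite_univ.prod (hfin _)).image g), Set.ncard_image_of_injective _ hf,
    Set.ncard_image_of_injective _ hg, Set.ncard_prod, Set.ncard_prod, Set.ncard_univ,
    Set.ncard_univ, Nat.card_units]

theorem ncard_lt_succ {α : Type*} (p : α → Prop) (h : α → WithBot ℕ) (n : ℕ)
    (hfin : {x | p x ∧ h x < (n + 1 : ℕ)}.Finite) :
    {x | p x ∧ h x < (n + 1 : ℕ)}.ncard =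
      {x | p x ∧ h x < n}.ncard + {x | p x ∧ h x = n}.ncard := by
  have hu : {x | p x ∧ h x < (n + 1 : ℕ)} = {x | p x ∧ h x < n} ∪ {x | p x ∧ h x = n} := by
    ext x
    simp only [Set.mem_ofPred_eq, Set.mem_union, ← and_or_left]
    refine and_congr_right fun _ => ?_
    induction h x
    · simp
    · rw [← Nat.cast_withBot, Nat.cast_lt, Nat.cast_lt, Nat.cast_inj]
      exact Nat.lt_succ_iff_lt_or_eq
  rw [hu] at hfin ⊢
  refine Set.ncard_union_eq (Set.disjoint_left.2 fun x h1 h2 => ?_)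
    (hfin.subset Set.subset_union_left) (hfin.subset Set.subset_union_right)
  exact h1.2.ne h2.2

/-- The larger of the degrees of two polynomials. -/
noncomputable def pairDegree {L : Type*} [Field L] (v : L[X] × L[X]) : WithBot ℕ :=
  max v.1.degree v.2.degree

/-- The pairs of coprime polynomials. -/
abbrev CoprimePair (L : Type*) [Field L] : Type _ :=
  {v : L[X] × L[X] // IsCoprime v.1 v.2}

section pairs

variable {L : Type*} [Field L]

theorem setOf_pairDegree_lt (n : ℕ) :
    {v : L[X] × L[X] | pairDegree v < n} =
      {p : L[X] | p.degree < n} ×ˢ {p : L[X] | p.degree < n} := by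
  ext; simp [pairDegree]

theorem finite_pairDegree_lt [Finite L] (n : ℕ) : {v : L[X] × L[X] | pairDegree v < n}.Finite := by
  rw [setOf_pairDegree_lt]
  exact (finite_degree_lt L n).prod (finite_degree_lt L n)

theorem finite_coprimePair_lt [Finite L] (n : ℕ) :
    {v : CoprimePair L | pairDegree v.1 < n}.Finite :=
  (finite_pairDegree_lt n).preimage Subtype.val_injective.injOn

theorem finite_coprimePair_add_lt [Finite L] (n : ℕ) :
    {v : CoprimePair L | pairDegree v.1 + pairDegree v.1 < n}.Finite := by
  refine (finite_coprimePair_lt n).subset fun v hv => ?_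
  simp only [Set.mem_ofPred_eq] at hv ⊢
  generalize pairDegree v.1 = d at *
  induction d with
  | bot => exact WithBot.bot_lt_coe n
  | coe d =>
    rw [← Nat.cast_withBot] at *
    norm_cast at *
    omega

theorem ncard_pairDegree_eq [Finite L] (e : ℕ) :
    (Nat.card L ^ (e + 1)) ^ 2 = (Nat.card L ^ e) ^ 2 +
      {v : L[X] × L[X] | pairDegree v = e}.ncard := by
  have h := ncard_lt_succ (fun _ => True) (pairDegree (L := L)) e
    (by simpa only [true_and] using finite_pairDegree_lt _)
  simp only [true_and, setOf_pairDegree_lt, Set.ncard_prod, ncard_degree_lt] at h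
  simpa only [sq] using h

theorem pairDegree_mul (g : L[X]) (v : L[X] × L[X]) :
    pairDegree (g * v.1, g * v.2) = g.degree + pairDegree v := by
  simp [pairDegree, degree_mul, add_max]

theorem exists_eq_mul_coprime (v : L[X] × L[X]) :
    ∃ (g : L[X]) (w : CoprimePair L), v = (g * w.1.1, g * w.1.2) := by
  classical
  let _ := EuclideanDomain.gcdMonoid L[X]
  obtain ⟨x, y, hx, hy, h⟩ := extract_gcd v.1 v.2
  exact ⟨_, ⟨(x, y), (EuclideanDomain.gcd_isUnit_iff).1 h⟩, Prod.ext hx hy⟩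

theorem eq_C_mul_of_mul_eq_mul {g g' : L[X]} {v v' : CoprimePair L} (hg : g ≠ 0)
    (h1 : g * v.1.1 = g' * v'.1.1) (h2 : g * v.1.2 = g' * v'.1.2) :
    ∃ u : Lˣ, g' = g * C (↑u⁻¹ : L) ∧ v'.1.1 = C (u : L) * v.1.1 ∧ v'.1.2 = C (u : L) * v.1.2 := by
  obtain ⟨⟨a, b⟩, c, d, hv⟩ := v
  obtain ⟨⟨a', b'⟩, c', d', hv'⟩ := v'
  simp only at *
  have hgg : g ∣ g' := ⟨c' * a + d' * b, by
    linear_combination (-g') * hv' - c' * h1 - d' * h2⟩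
  have hgg' : g' ∣ g := ⟨c * a' + d * b', by
    linear_combination (-g) * hv + c * h1 + d * h2⟩
  obtain ⟨⟨w, w', hw, hw'⟩, rfl⟩ := associated_of_dvd_dvd hgg hgg'
  obtain ⟨r, hr, rfl⟩ := isUnit_iff.1 (IsUnit.of_mul_eq_one w' hw)
  have hr0 := hr.ne_zero
  refine ⟨Units.mk0 r⁻¹ (inv_ne_zero hr0), by simp, ?_, ?_⟩
  · apply mul_left_cancel₀ (mul_ne_zero hg (C_ne_zero.2 hr0))
    have : (C r : L[X]) * C r⁻¹ = 1 := by rw [← C_mul, mul_inv_cancel₀ hr0, C_1]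
    rw [Units.val_mk0]
    linear_combination -h1 - g * a * this
  · apply mul_left_cancel₀ (mul_ne_zero hg (C_ne_zero.2 hr0))
    have : (C r : L[X]) * C r⁻¹ = 1 := by rw [← C_mul, mul_inv_cancel₀ hr0, C_1]
    rw [Units.val_mk0]
    linear_combination -h2 - g * b * this

theorem CoprimePair.ne_zero_or (v : CoprimePair L) : v.1.1 ≠ 0 ∨ v.1.2 ≠ 0 := by
  by_contra! h
  have := v.2
  rw [h.1, h.2] at this
  exact not_isCoprime_zero_zero this

/-- The pair `u v` for a nonzero constant `u`. -/
noncomputable def CoprimePair.scale (u : Lˣ) (v : CoprimePair L) : CoprimePair L :=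
  ⟨(C (u : L) * v.1.1, C (u : L) * v.1.2), by
    have hu : IsUnit (C (u : L)) := u.isUnit.map C
    exact (isCoprime_mul_unit_left hu _ _).2 v.2⟩

theorem CoprimePair.scale_injective (v : CoprimePair L) :
    Function.Injective fun u => CoprimePair.scale u v := by
  intro u u' h
  simp only [scale, Subtype.mk.injEq, Prod.mk.injEq] at h
  rcases v.ne_zero_or with hv | hv
  · simpa [hv, Units.val_inj] using h.1
  · simpa [hv, Units.val_inj] using h.2

theorem CoprimePair.pairDegree_scale (u : Lˣ) (v : CoprimePair L) :
    pairDegree (v.scale u).1 = pairDegree v.1 := by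
  simp [scale, pairDegree_mul, degree_C u.ne_zero]

theorem ncard_mul_coprime [Finite L] (e : ℕ) :
    {t : L[X] × CoprimePair L | t.1.degree + pairDegree t.2.1 = e}.ncard =
      (Nat.card L - 1) * {v : L[X] × L[X] | pairDegree v = e}.ncard := by
  rw [← Nat.card_units]
  refine ncard_eq_card_mul_ncard (finite_degree_add_eq _ finite_coprimePair_lt e)
    (fun t => (t.1 * t.2.1.1, t.1 * t.2.1.2)) (fun t ht => (pairDegree_mul _ _).trans ht)
    fun v hv => ?_
  obtain ⟨g, w, rfl⟩ := exists_eq_mul_coprime v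
  have hd : g.degree + pairDegree w.1 = e := (pairDegree_mul _ _).symm.trans hv
  have hg : g ≠ 0 := by rintro rfl; simp at hd
  refine ⟨fun u => (g * C (↑u⁻¹ : L), w.scale u), fun u u' h =>
    w.scale_injective (Prod.ext_iff.1 h).2, Set.ext fun ⟨g', w'⟩ => ?_⟩
  constructor
  · rintro ⟨u, h⟩
    obtain ⟨rfl, rfl⟩ := Prod.ext_iff.1 h
    have hu : (C (↑u⁻¹ : L) : L[X]) * C (u : L) = 1 := by rw [← C_mul]; simp
    refine ⟨?_, Prod.ext ?_ ?_⟩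
    · simp only [Set.mem_ofPred_eq, CoprimePair.pairDegree_scale, degree_mul,
        degree_C u⁻¹.ne_zero, add_zero, hd]
    · simp only [CoprimePair.scale]
      linear_combination g * w.1.1 * hu
    · simp only [CoprimePair.scale]
      linear_combination g * w.1.2 * hu
  · rintro ⟨-, h⟩
    obtain ⟨u, h0, h1, h2⟩ := eq_C_mul_of_mul_eq_mul (v := w) (v' := w') hg
      (Prod.ext_iff.1 h).1.symm (Prod.ext_iff.1 h).2.symm
    exact ⟨u, Prod.ext h0.symm (Subtype.ext (Prod.ext h1.symm h2.symm))⟩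

theorem ncard_coprimePair [Finite L] (e : ℕ) :
    ({v : CoprimePair L | pairDegree v.1 = (e + 1 : ℕ)}.ncard : ℚ) =
      ((Nat.card L : ℚ) ^ 2 - 1) * (Nat.card L : ℚ) ^ (2 * e + 1) * ((Nat.card L : ℚ) - 1) := by
  have h1 : 1 < Nat.card L := Finite.one_lt_card
  have h := ncard_degree_add_succ (L := L) (fun v : CoprimePair L => pairDegree v.1)
    finite_coprimePair_lt e
  rw [ncard_mul_coprime, ncard_mul_coprime] at h
  have b0 := ncard_pairDegree_eq (L := L) e
  have b1 := ncard_pairDegree_eq (L := L) (e + 1)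
  have hQ : (1 : ℚ) < Nat.card L := by exact_mod_cast h1
  have hQ' : (Nat.card L : ℚ) - 1 ≠ 0 := by linarith
  generalize {v : CoprimePair L | pairDegree v.1 = (e + 1 : ℕ)}.ncard = V at h ⊢
  generalize {v : L[X] × L[X] | pairDegree v = (e + 1 : ℕ)}.ncard = B at h b1
  apply_fun (fun n : ℕ => (n : ℚ)) at h b0 b1
  push_cast [Nat.cast_sub h1.le] at h b0 b1
  apply mul_left_cancel₀ hQ'
  set q := (Nat.card L : ℚ)
  have e1 : q ^ (2 * e + 1) = (q ^ e) ^ 2 * q := by ring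
  rw [e1]
  simp only [pow_succ q] at b0 b1 ⊢
  linear_combination -h + (q - 1) * q * b0 - (q - 1) * b1

end pairs

/-- The triple `(x, y, z)` encodes a Hermitian `2 × 2` matrix with rows `(x, z)`, `(s z, y)` and
determinant zero, where `s` is the conjugation. -/
structure IsSingularHermitian {R : Type*} [CommRing R] (s : R →+* R) (m : R × R × R) : Prop where
  fst : s m.1 = m.1
  snd : s m.2.1 = m.2.1
  det : m.1 * m.2.1 = m.2.2 * s m.2.2

theorem IsSingularHermitian.exists_of_eq_mul {R : Type*} [CommRing R] [IsDomain R] {s : R →+* R}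
    (hs : ∀ r, s (s r) = r) {x y z : R} (hm : IsSingularHermitian s (x, y, z)) {g v w : R}
    (hg : g ≠ 0) (hvw : IsCoprime v w) (hx : x = g * v) (hz : s z = g * w) :
    ∃ k, s k = k ∧ x = k * (v * s v) ∧ y = k * (w * s w) ∧ z = k * (v * s w) := by
  obtain ⟨a, b, hab⟩ := hvw
  obtain ⟨h1, h2, h3⟩ := hm
  simp only at h1 h2 h3
  have hvy : v * y = z * w := mul_left_cancel₀ hg (by linear_combination h3 - y * hx + z * hz)
  have hab' : s a * s v + s b * s w = 1 := by simpa using congrArg s hab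
  have hx' : x = s g * s v := by rw [← h1, hx, map_mul]
  have hz' : z = s g * s w := by rw [← hs z, hz, map_mul]
  have hvy' : s v * y = s z * s w := by rw [← map_mul, ← hvy, map_mul, h2]
  let h := a * z + b * y
  have hhv : h * v = z := by simp only [h]; linear_combination b * hvy + z * hab
  have hhw : h * w = y := by simp only [h]; linear_combination (-a) * hvy + y * hab
  have hhv' : s h * s v = s z := by rw [← map_mul, hhv]
  have hhw' : s h * s w = y := by rw [← map_mul, hhw, h2]
  let k := a * s g + b * s h
  have hk : k * s v = g := by
    simp only [k]; linear_combination a * (hx - hx') + b * (hhv' + hz) + g * hab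
  have hk' : k * s w = h := by
    simp only [k]; linear_combination a * (-hz' - hhv) + b * (hhw' - hhw) + h * hab
  have ex : x = k * (v * s v) := by linear_combination hx - v * hk
  have ey : y = k * (w * s w) := by linear_combination (-hhw) - w * hk'
  have ez : z = k * (v * s w) := by linear_combination (-hhv) - v * hk'
  have ez' : s z = k * (w * s v) := by linear_combination hz - w * hk
  have ek : k = a * s a * x + a * s b * z + b * s a * s z + b * s b * y := by
    rw [ex, ey, ez', ez]
    linear_combination (-k) * (s a * s v + s b * s w) * hab - k * hab'
  refine ⟨k, ?_, ex, ey, ez⟩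
  rw [ek]
  simp only [map_add, map_mul, hs, h1, h2]
  ring

/-- The largest degree of three polynomials. -/
noncomputable def tripleDegree {L : Type*} [Field L] (m : L[X] × L[X] × L[X]) : WithBot ℕ :=
  max (max m.1.degree m.2.1.degree) m.2.2.degree

/-- The multiple by `k` of the rank one Hermitian matrix `v v*`. -/
noncomputable def rankOne {R : Type*} [CommRing R] (s : R →+* R) (k : R) (v : R × R) : R × R × R :=
  (k * (v.1 * s v.1), k * (v.2 * s v.2), k * (v.1 * s v.2))

section hermitian

variable {F K : Type*} [Field F] [Field K] [Algebra F K] {σ : K →+* K}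

theorem mapRingHom_involutive (hσ : ∀ x, σ (σ x) = x) (p : K[X]) :
    mapRingHom σ (mapRingHom σ p) = p := by
  ext n; simp [hσ]

theorem exists_map_eq_of_mapRingHom_eq (hfix : ∀ x, σ x = x ↔ x ∈ Set.range (algebraMap F K))
    {p : K[X]} (hp : mapRingHom σ p = p) : ∃ k : F[X], k.map (algebraMap F K) = p := by
  rw [← mem_lifts, lifts_iff_coeff_lifts]
  intro n
  rw [← hfix]
  conv_rhs => rw [← hp]
  simp

theorem mapRingHom_map (hfix : ∀ x, σ x = x ↔ x ∈ Set.range (algebraMap F K)) (k : F[X]) :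
    mapRingHom σ (k.map (algebraMap F K)) = k.map (algebraMap F K) := by
  ext n; simp [hfix]

theorem tripleDegree_rankOne (k : F[X]) (v : K[X] × K[X]) :
    tripleDegree (rankOne (mapRingHom σ) (k.map (algebraMap F K)) v) =
      k.degree + (pairDegree v + pairDegree v) := by
  simp only [tripleDegree, rankOne, pairDegree, degree_mul, degree_map, coe_mapRingHom]
  rw [← add_max, ← add_max]
  congr 1
  rcases le_total v.1.degree v.2.degree with h | h
  · rw [max_eq_right h, max_eq_right (add_le_add h h), max_eq_left (add_le_add h le_rfl)]
  · rw [max_eq_left h, max_eq_left (add_le_add h h), max_eq_left (add_le_add le_rfl h)]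

theorem isSingularHermitian_rankOne (hσ : ∀ x, σ (σ x) = x)
    (hfix : ∀ x, σ x = x ↔ x ∈ Set.range (algebraMap F K)) (k : F[X]) (v : K[X] × K[X]) :
    IsSingularHermitian (mapRingHom σ)
      (rankOne (mapRingHom σ) (k.map (algebraMap F K)) v) := by
  constructor <;> simp only [rankOne, map_mul, mapRingHom_involutive hσ, mapRingHom_map hfix] <;>
    ring

theorem IsSingularHermitian.exists_rankOne (hσ : ∀ x, σ (σ x) = x)
    (hfix : ∀ x, σ x = x ↔ x ∈ Set.range (algebraMap F K)) {m : K[X] × K[X] × K[X]}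
    (hm : IsSingularHermitian (mapRingHom σ) m) :
    ∃ (k : F[X]) (v : CoprimePair K),
      rankOne (mapRingHom σ) (k.map (algebraMap F K)) v.1 = m := by
  obtain ⟨x, y, z⟩ := m
  obtain ⟨g, v, hv⟩ := exists_eq_mul_coprime (x, mapRingHom σ z)
  obtain ⟨hx, hz⟩ := Prod.ext_iff.1 hv
  simp only at hx hz
  by_cases hg : g = 0
  · obtain ⟨k, hk⟩ := exists_map_eq_of_mapRingHom_eq hfix hm.snd
    rw [hg, zero_mul] at hx hz
    have hz0 : z = 0 := by rw [← mapRingHom_involutive hσ z, hz, map_zero]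
    refine ⟨k, ⟨(0, 1), isCoprime_one_right⟩, ?_⟩
    simp [rankOne, hx, hz0, hk]
  · obtain ⟨k, hk, h1, h2, h3⟩ := hm.exists_of_eq_mul (mapRingHom_involutive hσ) hg v.2 hx hz
    obtain ⟨k, rfl⟩ := exists_map_eq_of_mapRingHom_eq hfix hk
    exact ⟨k, v, Prod.ext h1.symm (Prod.ext h2.symm h3.symm)⟩

theorem rankOne_scale (k : K[X]) (u : Kˣ) (v : CoprimePair K) :
    rankOne (mapRingHom σ) k (v.scale u).1 =
      rankOne (mapRingHom σ) (k * C (u * σ u : K)) v.1 := by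
  simp only [rankOne, CoprimePair.scale, map_mul, coe_mapRingHom, map_C]
  refine Prod.ext ?_ (Prod.ext ?_ ?_) <;> ring

theorem eq_scale_of_rankOne_eq (hσ : ∀ x, σ (σ x) = x)
    (hfix : ∀ x, σ x = x ↔ x ∈ Set.range (algebraMap F K)) {k k' : F[X]}
    {v v' : CoprimePair K} (hk : k ≠ 0)
    (h : rankOne (mapRingHom σ) (k.map (algebraMap F K)) v.1 =
      rankOne (mapRingHom σ) (k'.map (algebraMap F K)) v'.1) :
    ∃ u : Kˣ, v' = v.scale u ∧
      k.map (algebraMap F K) = k'.map (algebraMap F K) * C (u * σ u : K) := by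
  have hs := mapRingHom_involutive hσ
  have hk0 : k.map (algebraMap F K) ≠ 0 :=
    (Polynomial.map_ne_zero_iff (algebraMap F K).injective).2 hk
  have hsk := mapRingHom_map hfix k
  have hsk' := mapRingHom_map hfix k'
  generalize k.map (algebraMap F K) = κ at *
  generalize k'.map (algebraMap F K) = κ' at *
  obtain ⟨h1, h2, h3⟩ : _ ∧ _ ∧ _ := by simpa only [rankOne, Prod.mk.injEq] using h
  have h4 := congrArg (mapRingHom σ) h3
  obtain ⟨a, b, hab⟩ := v.2
  have hab' := congrArg (mapRingHom σ) hab
  simp only [map_mul, map_add, map_one, hs, hsk, hsk'] at h4 hab'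
  obtain ⟨u, -, hu1, hu2⟩ := eq_C_mul_of_mul_eq_mul (v := v) (v' := v') (g := κ)
    (g' := κ' * (mapRingHom σ a * mapRingHom σ v'.1.1 + mapRingHom σ b * mapRingHom σ v'.1.2)) hk0
    (by linear_combination (-κ * v.1.1) * hab' + mapRingHom σ a * h1 + mapRingHom σ b * h3)
    (by linear_combination (-κ * v.1.2) * hab' + mapRingHom σ a * h4 + mapRingHom σ b * h2)
  have hv : v' = v.scale u := Subtype.ext (Prod.ext hu1 hu2)
  refine ⟨u, hv, ?_⟩
  rw [hv, rankOne_scale] at h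
  obtain ⟨h1, h2, -⟩ : _ ∧ _ ∧ _ := by simpa only [rankOne, Prod.mk.injEq] using h
  have hne : ∀ p : K[X], p ≠ 0 → p * mapRingHom σ p ≠ 0 := fun p hp =>
    mul_ne_zero hp ((map_ne_zero_iff _ (Function.LeftInverse.injective hs)).2 hp)
  rcases v.ne_zero_or with hv | hv
  · exact mul_right_cancel₀ (hne _ hv) h1
  · exact mul_right_cancel₀ (hne _ hv) h2

theorem ncard_mul_rankOne [Finite F] [Finite K] (hσ : ∀ x, σ (σ x) = x)
    (hfix : ∀ x, σ x = x ↔ x ∈ Set.range (algebraMap F K)) (P : ℕ) :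
    {t : F[X] × CoprimePair K |
        t.1.degree + (pairDegree t.2.1 + pairDegree t.2.1) = P}.ncard =
      (Nat.card K - 1) * {m : K[X] × K[X] × K[X] |
        IsSingularHermitian (mapRingHom σ) m ∧ tripleDegree m = P}.ncard := by
  rw [← Nat.card_units]
  refine ncard_eq_card_mul_ncard
    (finite_degree_add_eq _ finite_coprimePair_add_lt P)
    (fun t => rankOne (mapRingHom σ) (t.1.map (algebraMap F K)) t.2.1)
    (fun t ht => ⟨isSingularHermitian_rankOne hσ hfix _ _, (tripleDegree_rankOne _ _).trans ht⟩)
    ?_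
  rintro _ ⟨hm, hd⟩
  obtain ⟨k, v, rfl⟩ := hm.exists_rankOne hσ hfix
  rw [tripleDegree_rankOne] at hd
  have hk : k ≠ 0 := by rintro rfl; simp at hd
  have hnorm : ∀ u : Kˣ, ∃ n : F, algebraMap F K n = (u * σ u : K)⁻¹ := fun u =>
    (hfix _).1 (by rw [map_inv₀, map_mul, hσ, mul_comm])
  choose n hn using hnorm
  have hn0 : ∀ u, n u ≠ 0 := fun u h => by
    have := hn u
    rw [h, map_zero, eq_comm, inv_eq_zero] at this
    simp at this
  have hcancel : ∀ u : Kˣ, C ((u * σ u : K)⁻¹) * C (u * σ u : K) = 1 := fun u => by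
    rw [← C_mul, inv_mul_cancel₀ (by simp), C_1]
  refine ⟨fun u => (k * C (n u), v.scale u), fun u u' h =>
    v.scale_injective (Prod.ext_iff.1 h).2, Set.ext fun ⟨k', v'⟩ => ?_⟩
  constructor
  · rintro ⟨u, h⟩
    obtain ⟨rfl, rfl⟩ := Prod.ext_iff.1 h
    refine ⟨?_, ?_⟩
    · simp only [Set.mem_ofPred_eq, CoprimePair.pairDegree_scale, degree_mul, degree_C (hn0 u),
        add_zero, hd]
    · simp only [rankOne_scale, Polynomial.map_mul, map_C, hn, mul_assoc, hcancel, mul_one]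
  · rintro ⟨-, h⟩
    obtain ⟨u, rfl, hu⟩ := eq_scale_of_rankOne_eq hσ hfix hk h.symm
    refine ⟨u, Prod.ext (map_injective _ (algebraMap F K).injective ?_) rfl⟩
    simp only [Polynomial.map_mul, map_C, hn, hu]
    rw [mul_assoc, ← mul_comm (C _), hcancel, mul_one]

theorem setOf_pairDegree_add_eq_even (e : ℕ) :
    {v : CoprimePair K | pairDegree v.1 + pairDegree v.1 = (2 * e : ℕ)} =
      {v : CoprimePair K | pairDegree v.1 = e} := by
  ext v
  constructor
  · intro h
    obtain ⟨i, j, hi, hj, hij⟩ := withBot_add_eq_natCast h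
    have : i = j := by rw [hi] at hj; exact_mod_cast hj
    exact hi.trans (by congr 1; omega)
  · intro h
    simp only [Set.mem_ofPred_eq] at h ⊢
    rw [h, two_mul, Nat.cast_add]

theorem setOf_pairDegree_add_eq_odd {P : ℕ} (hP : ¬ Even P) :
    {v : CoprimePair K | pairDegree v.1 + pairDegree v.1 = P} = ∅ := by
  refine Set.eq_empty_of_forall_notMem fun v h => hP ?_
  obtain ⟨i, j, hi, hj, hij⟩ := withBot_add_eq_natCast h
  have : i = j := by rw [hi] at hj; exact_mod_cast hj
  exact ⟨i, by omega⟩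

theorem ncard_singularHermitian_succ [Finite F] [Finite K] (hσ : ∀ x, σ (σ x) = x)
    (hfix : ∀ x, σ x = x ↔ x ∈ Set.range (algebraMap F K)) (hcard : Nat.card K = Nat.card F ^ 2)
    (P : ℕ) :
    ({m : K[X] × K[X] × K[X] | IsSingularHermitian (mapRingHom σ) m ∧
        tripleDegree m = (P + 1 : ℕ)}.ncard : ℚ) - Nat.card F *
      {m : K[X] × K[X] × K[X] | IsSingularHermitian (mapRingHom σ) m ∧ tripleDegree m = P}.ncard =
    if Even (P + 1) then
      ((Nat.card F : ℚ) - 1) * ((Nat.card F : ℚ) ^ 4 - 1) * (Nat.card F : ℚ) ^ (2 * P)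
    else 0 := by
  have h1 : 1 < Nat.card F := Finite.one_lt_card
  have hK : 1 < Nat.card K := Finite.one_lt_card
  have h := ncard_degree_add_succ (L := F)
    (fun v : CoprimePair K => pairDegree v.1 + pairDegree v.1) finite_coprimePair_add_lt P
  rw [ncard_mul_rankOne hσ hfix, ncard_mul_rankOne hσ hfix, hcard] at h
  rw [hcard] at hK
  generalize {m : K[X] × K[X] × K[X] | IsSingularHermitian (mapRingHom σ) m ∧
    tripleDegree m = (P + 1 : ℕ)}.ncard = A' at h ⊢
  generalize {m : K[X] × K[X] × K[X] | IsSingularHermitian (mapRingHom σ) m ∧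
    tripleDegree m = P}.ncard = A at h ⊢
  have hQ' : (Nat.card F : ℚ) ^ 2 - 1 ≠ 0 := by
    have : (1 : ℚ) < Nat.card F := by exact_mod_cast h1
    nlinarith
  apply mul_left_cancel₀ hQ'
  split_ifs with hP
  · obtain ⟨e, he⟩ := hP
    obtain ⟨e, rfl⟩ : ∃ e', e = e' + 1 := ⟨e - 1, by omega⟩
    obtain rfl : P = 2 * e + 1 := by omega
    have hV := ncard_coprimePair (L := K) e
    rw [show 2 * e + 1 + 1 = 2 * (e + 1) by ring, setOf_pairDegree_add_eq_even] at h
    generalize {v : CoprimePair K | pairDegree v.1 = (e + 1 : ℕ)}.ncard = V at h hV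
    apply_fun (fun n : ℕ => (n : ℚ)) at h
    push_cast [Nat.cast_sub h1.le, Nat.cast_sub hK.le, hcard] at h hV
    rw [hV] at h
    linear_combination h
  · rw [setOf_pairDegree_add_eq_odd hP, Set.ncard_empty] at h
    apply_fun (fun n : ℕ => (n : ℚ)) at h
    push_cast [Nat.cast_sub h1.le, Nat.cast_sub hK.le, hcard] at h
    linear_combination h

end hermitian

section normalForm

variable {F : Type} [Field F]

theorem degree_C_mul_add_C_mul_lt {R : Type*} [Field R] {p q : R[X]} {n : WithBot ℕ}
    (hp : p.degree < n) (hq : q.degree < n) (a b : R) : (C a * p + C b * q).degree < n := by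
  refine (degree_add_le _ _).trans_lt (max_lt ?_ ?_)
  · rw [← smul_eq_C_mul]; exact (degree_smul_le _ _).trans_lt hp
  · rw [← smul_eq_C_mul]; exact (degree_smul_le _ _).trans_lt hq

theorem diagCount_comp_perm {n : ℕ} (e : Equiv.Perm (Fin n)) (a : Fin n → F) (P : ℕ) :
    diagCount (a ∘ e) P = diagCount a P := by
  refine (Nat.card_congr ((e.arrowCongr (Equiv.refl _)).symm.subtypeEquiv fun x => ?_)).symm
  have h : ∀ i, (e.arrowCongr (Equiv.refl F[X])).symm x i = x (e i) := fun _ => rfl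
  simp only [h, Function.comp_apply]
  refine and_congr (e.forall_congr_right (q := fun i => (x i).degree < P)).symm ?_
  rw [Equiv.sum_comp e fun i => C (a i) * x i ^ 2]

theorem exists_mul_sq_add_mul_sq_eq [Finite F] (hchar : ringChar F ≠ 2) {a b : F} (ha : a ≠ 0)
    (hb : b ≠ 0) (e : F) : ∃ u v, a * u ^ 2 + b * v ^ 2 = e := by
  have := Fintype.ofFinite F
  obtain ⟨u, v, h⟩ := FiniteField.exists_root_sum_quadratic (f := C a * X ^ 2)
    (g := C b * X ^ 2 - C e) (degree_C_mul_X_pow 2 ha)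
    (by rw [degree_sub_C] <;> rw [degree_C_mul_X_pow 2 hb]; · rfl
        · exact_mod_cast Nat.succ_pos 1) (FiniteField.odd_card_of_char_ne_two hchar)
  exact ⟨u, v, by simpa [sub_eq_zero, ← add_sub_assoc] using h⟩

theorem diagCount_change_binary [Finite F] (hchar : ringChar F ≠ 2) {a b e : F} (ha : a ≠ 0)
    (hb : b ≠ 0) (he : e ≠ 0) (c d : F) (P : ℕ) :
    diagCount ![a, b, c, d] P = diagCount ![e, a * b * e, c, d] P := by
  obtain ⟨u, v, huv⟩ := exists_mul_sq_add_mul_sq_eq hchar ha hb e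
  have hC : C a * C u ^ 2 + C b * C v ^ 2 = C e := by rw [← huv]; simp
  have hinv : C e * C e⁻¹ = 1 := by rw [← C_mul, mul_inv_cancel₀ he, C_1]
  let f : (Fin 4 → F[X]) → (Fin 4 → F[X]) := fun x =>
    ![C (e⁻¹ * (a * u)) * x 0 + C (e⁻¹ * (b * v)) * x 1,
      C (-(e⁻¹ * v)) * x 0 + C (e⁻¹ * u) * x 1, x 2, x 3]
  let g : (Fin 4 → F[X]) → (Fin 4 → F[X]) := fun y =>
    ![C u * y 0 + C (-(b * v)) * y 1, C v * y 0 + C (a * u) * y 1, y 2, y 3]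
  have hgf : ∀ x, g (f x) = x := fun x => by
    simp only [f, g, C_mul, C_neg]
    ext1 i
    fin_cases i
    · simp
      linear_combination C e⁻¹ * x 0 * hC + x 0 * hinv
    · simp
      linear_combination C e⁻¹ * x 1 * hC + x 1 * hinv
    · rfl
    · rfl
  have hfg : ∀ y, f (g y) = y := fun y => by
    simp only [f, g, C_mul, C_neg]
    ext1 i
    fin_cases i
    · simp
      linear_combination C e⁻¹ * y 0 * hC + y 0 * hinv
    · simp
      linear_combination C e⁻¹ * y 1 * hC + y 1 * hinv
    · rfl
    · rfl
  have hform : ∀ y, ∑ i, C (![e, a * b * e, c, d] i) * y i ^ 2 =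
      ∑ i, C (![a, b, c, d] i) * g y i ^ 2 := fun y => by
    simp [Fin.sum_univ_four, g]
    linear_combination (-y 0 ^ 2 - C a * C b * y 1 ^ 2) * hC
  have hf : ∀ x : Fin 4 → F[X], (∀ i, (x i).degree < P) → ∀ i, (f x i).degree < P := by
    intro x h
    simp only [Fin.forall_fin_succ, f]
    exact ⟨degree_C_mul_add_C_mul_lt (h 0) (h 1) _ _, degree_C_mul_add_C_mul_lt (h 0) (h 1) _ _,
      h 2, h 3, fun i => i.elim0⟩
  have hg : ∀ y : Fin 4 → F[X], (∀ i, (y i).degree < P) → ∀ i, (g y i).degree < P := by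
    intro y h
    simp only [Fin.forall_fin_succ, g]
    exact ⟨degree_C_mul_add_C_mul_lt (h 0) (h 1) _ _, degree_C_mul_add_C_mul_lt (h 0) (h 1) _ _,
      h 2, h 3, fun i => i.elim0⟩
  clear_value f g
  let φ : (Fin 4 → F[X]) ≃ (Fin 4 → F[X]) := ⟨f, g, hgf, hfg⟩
  refine Nat.card_congr (φ.subtypeEquiv fun x => ?_)
  show _ ↔ (∀ i, (f x i).degree < P) ∧ ∑ i, C (![e, a * b * e, c, d] i) * f x i ^ 2 = 0
  rw [hform, hgf]
  exact and_congr_left fun _ => ⟨hf x, fun h => hgf x ▸ hg _ h⟩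

theorem diagCount_eq_normalForm [Finite F] (hchar : ringChar F ≠ 2) {a : Fin 4 → F}
    (ha : ∀ i, a i ≠ 0) (P : ℕ) :
    diagCount a P = diagCount ![1, -1, -1, ∏ i, a i] P := by
  have hperm : ∀ {a b : Fin 4 → F} (e : Equiv.Perm (Fin 4)), a = b ∘ e →
      diagCount a P = diagCount b P := fun e h => h ▸ diagCount_comp_perm e _ P
  have h0 : a = ![a 0, a 1, a 2, a 3] := by ext i; fin_cases i <;> rfl
  have h1 : (-1 : F) ≠ 0 := neg_ne_zero.2 one_ne_zero
  have h01 := mul_ne_zero (mul_ne_zero (ha 0) (ha 1)) one_ne_zero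
  have h012 := mul_ne_zero (mul_ne_zero h01 (ha 2)) h1
  calc
    diagCount a P = diagCount ![a 0, a 1, a 2, a 3] P := by rw [← h0]
    _ = diagCount ![1, a 0 * a 1 * 1, a 2, a 3] P :=
      diagCount_change_binary hchar (ha 0) (ha 1) one_ne_zero _ _ P
    _ = diagCount ![a 0 * a 1 * 1, a 2, 1, a 3] P :=
      hperm (Equiv.swap 0 2 * Equiv.swap 1 2) (by ext i; fin_cases i <;> rfl)
    _ = diagCount ![-1, a 0 * a 1 * 1 * a 2 * (-1), 1, a 3] P :=
      diagCount_change_binary hchar h01 (ha 2) h1 _ _ P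
    _ = diagCount ![a 0 * a 1 * 1 * a 2 * (-1), a 3, -1, 1] P :=
      hperm (Equiv.swap 0 1 * Equiv.swap 0 3 * Equiv.swap 0 2) (by ext i; fin_cases i <;> rfl)
    _ = diagCount ![-1, a 0 * a 1 * 1 * a 2 * (-1) * a 3 * (-1), -1, 1] P :=
      diagCount_change_binary hchar h012 (ha 3) h1 _ _ P
    _ = diagCount ![1, -1, -1, a 0 * a 1 * 1 * a 2 * (-1) * a 3 * (-1)] P :=
      hperm (Equiv.swap 0 3 * Equiv.swap 0 1) (by ext i; fin_cases i <;> rfl)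
    _ = diagCount ![1, -1, -1, ∏ i, a i] P := by
      rw [Fin.prod_univ_four]; congr 3; ring_nf

end normalForm

section count

variable {F K : Type} [Field F] [Field K] [Algebra F K] {σ : K →+* K}

theorem finite_tripleDegree_lt (L : Type*) [Field L] [Finite L] (n : ℕ) :
    {m : L[X] × L[X] × L[X] | tripleDegree m < n}.Finite := by
  refine ((finite_degree_lt L n).prod ((finite_degree_lt L n).prod (finite_degree_lt L n))).subset
    fun m hm => ?_
  simpa [tripleDegree, and_assoc] using hm

theorem diagCount_eq_ncard_singularHermitian
    (hfix : ∀ x, σ x = x ↔ x ∈ Set.range (algebraMap F K)) (h2 : (2 : F) ≠ 0) {ω : K} {D : F}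
    (hω : ω ≠ 0) (hωσ : σ ω = -ω) (hωD : ω ^ 2 = algebraMap F K D) (hσ : ∀ x, σ (σ x) = x) (P : ℕ) :
    diagCount ![1, -1, -1, D] P =
      {m | IsSingularHermitian (mapRingHom σ) m ∧ tripleDegree m < P}.ncard := by
  set s := mapRingHom σ with hs
  let ι : F[X] →+* K[X] := mapRingHom (algebraMap F K)
  have hι : Function.Injective ι := map_injective _ (algebraMap F K).injective
  have hsι : ∀ p, s (ι p) = ι p := mapRingHom_map hfix
  have hss : ∀ p, s (s p) = p := mapRingHom_involutive hσ
  have hsω : s (C ω) = -C ω := by simp [hs, hωσ]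
  have hω2 : C ω * C ω = ι (C D) := by
    rw [← C_mul, ← sq, hωD]; simp [ι]
  have hlift : ∀ p, s p = p → ∃ k, ι k = p := fun p hp => exists_map_eq_of_mapRingHom_eq hfix hp
  have hdeg : ∀ p, (ι p).degree = p.degree := fun p => degree_map _ _
  have hsdeg : ∀ p, (s p).degree = p.degree := fun p => degree_map _ _
  have h2K : (2 : K) ≠ 0 := by
    rw [← map_ofNat (algebraMap F K) 2]
    exact (_root_.map_ne_zero _).2 h2
  have hhalf : (C (2⁻¹ : K)) * 2 = 1 := by
    rw [← C_ofNat, ← C_mul]; simp [h2K]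
  have hhalfF : (C (2⁻¹ : F)) * 2 = 1 := by
    rw [← C_ofNat, ← C_mul]; simp [h2]
  have hs2 : s (C 2⁻¹) = C 2⁻¹ := by
    rw [hs, coe_mapRingHom, map_C, map_inv₀, map_ofNat]
  have hsωi : s (C ω⁻¹) = -C ω⁻¹ := by simp [hs, hωσ, inv_neg]
  have hωi : C ω * C ω⁻¹ = 1 := by rw [← C_mul, mul_inv_cancel₀ hω, C_1]
  let f : (Fin 4 → F[X]) → K[X] × K[X] × K[X] := fun x =>
    (ι (x 0 + x 1), ι (x 0 - x 1), ι (x 2) + C ω * ι (x 3))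
  have hf : f.Injective := by
    intro x y h
    simp only [f, Prod.mk.injEq, hι.eq_iff] at h
    obtain ⟨ha, hb, hc⟩ := h
    have hc' := congrArg s hc
    simp only [map_add, map_mul, hsι, hsω] at hc'
    ext1 i
    fin_cases i
    · show x 0 = y 0
      linear_combination C 2⁻¹ * (ha + hb) + (y 0 - x 0) * hhalfF
    · show x 1 = y 1
      linear_combination C 2⁻¹ * (ha - hb) + (y 1 - x 1) * hhalfF
    · exact hι (show ι (x 2) = ι (y 2) by
        linear_combination C 2⁻¹ * (hc + hc') + (ι (y 2) - ι (x 2)) * hhalf)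
    · exact hι (show ι (x 3) = ι (y 3) by
        linear_combination C ω⁻¹ * C 2⁻¹ * (hc - hc') +
          (ι (y 3) - ι (x 3)) * (hhalf + C 2⁻¹ * 2 * hωi))
  rw [diagCount, ← Set.coe_ofPred, Nat.card_coe_set_eq, ← Set.ncard_image_of_injective _ hf]
  congr 1
  ext ⟨x, y, z⟩
  simp only [Set.mem_image, Set.mem_ofPred_eq]
  constructor
  · rintro ⟨k, ⟨hk, h⟩, hxyz⟩
    simp only [f, Prod.mk.injEq] at hxyz
    obtain ⟨rfl, rfl, rfl⟩ := hxyz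
    refine ⟨⟨hsι _, hsι _, ?_⟩, ?_⟩
    · have := congrArg ι h
      simp [Fin.sum_univ_four] at this
      simp [hsι, hsω]
      linear_combination this + ι (k 3) ^ 2 * hω2
    · simp only [tripleDegree, max_lt_iff, hdeg]
      refine ⟨⟨(degree_add_le _ _).trans_lt (max_lt (hk 0) (hk 1)),
        (degree_sub_le _ _).trans_lt (max_lt (hk 0) (hk 1))⟩,
        (degree_add_le _ _).trans_lt (max_lt ((hdeg _).trans_lt (hk 2)) ?_)⟩
      rw [degree_C_mul hω, hdeg]
      exact hk 3
  · rintro ⟨⟨hx, hy, hxyz⟩, hm⟩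
    simp only at hx hy hxyz
    simp only [tripleDegree, max_lt_iff] at hm
    obtain ⟨x, rfl⟩ := hlift x hx
    obtain ⟨y, rfl⟩ := hlift y hy
    obtain ⟨u, hu⟩ := hlift (C 2⁻¹ * (z + s z)) (by
      simp only [map_mul, map_add, hss, hs2]; ring)
    obtain ⟨v, hv⟩ := hlift (C ω⁻¹ * C 2⁻¹ * (z - s z)) (by
      simp only [map_mul, map_sub, hss, hs2, hsωi]; ring)
    simp only [hdeg] at hm
    have hz : ι u + C ω * ι v = z := by
      rw [hu, hv]
      linear_combination z * hhalf + C 2⁻¹ * (z - s z) * hωi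
    have hsz : (s z).degree < P := (hsdeg z).trans_lt hm.2
    have hud : u.degree < P := by
      rw [← hdeg, hu, mul_add]
      exact degree_C_mul_add_C_mul_lt hm.2 hsz _ _
    have hvd : v.degree < P := by
      rw [← hdeg, hv, ← C_mul, mul_sub, sub_eq_add_neg, ← neg_mul, ← C_neg]
      exact degree_C_mul_add_C_mul_lt hm.2 hsz _ _
    refine ⟨![C 2⁻¹ * x + C 2⁻¹ * y, C 2⁻¹ * x + C (-2⁻¹) * y, u, v], ⟨?_, ?_⟩, ?_⟩
    · simp only [Fin.forall_fin_succ]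
      exact ⟨degree_C_mul_add_C_mul_lt hm.1.1 hm.1.2 _ _,
        degree_C_mul_add_C_mul_lt hm.1.1 hm.1.2 _ _, hud, hvd, fun i => i.elim0⟩
    · apply hι
      rw [← hz] at hxyz
      simp [hsι, hsω] at hxyz
      have hι2 := congrArg ι hhalfF
      rw [map_mul, map_ofNat, map_one] at hι2
      simp [Fin.sum_univ_four]
      linear_combination hxyz - ι v ^ 2 * hω2 +
        ι x * ι y * (1 + ι (C 2⁻¹) * 2) * hι2
    · have hx' : C 2⁻¹ * x + C 2⁻¹ * y + (C 2⁻¹ * x + C (-2⁻¹) * y) = x := by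
        rw [C_neg]; linear_combination x * hhalfF
      have hy' : C 2⁻¹ * x + C 2⁻¹ * y - (C 2⁻¹ * x + C (-2⁻¹) * y) = y := by
        rw [C_neg]; linear_combination y * hhalfF
      exact Prod.ext (congrArg ι hx') (Prod.ext (congrArg ι hy') hz)

end count

theorem diagCount_succ_sub_eq {F : Type} [Field F] [Finite F] (h2 : (2 : F) ≠ 0) {D : F}
    (hD : ¬ IsSquare D) (P : ℕ) :
    ((diagCount ![1, -1, -1, D] (P + 2) : ℚ) - diagCount ![1, -1, -1, D] (P + 1)) -
      Nat.card F * (diagCount ![1, -1, -1, D] (P + 1) - diagCount ![1, -1, -1, D] P) =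
      if Even (P + 1) then ((Nat.card F : ℚ) - 1) * ((Nat.card F : ℚ) ^ 4 - 1) *
        (Nat.card F : ℚ) ^ (2 * P) else 0 := by
  have : Fact (∀ r : F, r ^ 2 ≠ D + 0 * r) :=
    ⟨fun r h => hD ⟨r, by rw [← sq, h, zero_mul, add_zero]⟩⟩
  have : Finite (QuadraticAlgebra F D 0) :=
    Finite.of_equiv _ (QuadraticAlgebra.equivProd D 0).symm
  let τ : QuadraticAlgebra F D 0 →+* QuadraticAlgebra F D 0 := starRingEnd _
  have hσ : ∀ x : QuadraticAlgebra F D 0, τ (τ x) = x := star_star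
  have hfix : ∀ x : QuadraticAlgebra F D 0,
      τ x = x ↔ x ∈ Set.range (algebraMap F (QuadraticAlgebra F D 0)) := by
    intro x
    rw [show τ x = star x from rfl, QuadraticAlgebra.ext_iff]
    constructor
    · rintro ⟨-, h⟩
      refine ⟨x.re, QuadraticAlgebra.ext rfl ?_⟩
      rw [QuadraticAlgebra.im_star] at h
      have : 2 * x.im = 0 := by linear_combination -h
      exact ((mul_eq_zero.1 this).resolve_left h2).symm
    · rintro ⟨r, rfl⟩
      simp
  have hcard : Nat.card (QuadraticAlgebra F D 0) = Nat.card F ^ 2 := by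
    rw [Nat.card_congr (QuadraticAlgebra.equivProd D 0), Nat.card_prod, sq]
  have hω : (QuadraticAlgebra.omega : QuadraticAlgebra F D 0) ≠ 0 := fun h => by
    simpa using congrArg QuadraticAlgebra.im h
  have hωσ : τ QuadraticAlgebra.omega = -QuadraticAlgebra.omega := by
    rw [show ∀ x, τ x = star x from fun _ => rfl]
    ext <;> simp
  have hωD : (QuadraticAlgebra.omega : QuadraticAlgebra F D 0) ^ 2 = algebraMap F _ D := by
    ext <;> simp [sq]
  have hcount := diagCount_eq_ncard_singularHermitian hfix h2 hω hωσ hωD hσ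
  have hsucc : ∀ n, diagCount ![1, -1, -1, D] (n + 1) = diagCount ![1, -1, -1, D] n +
      {m | IsSingularHermitian (mapRingHom τ) m ∧ tripleDegree m = n}.ncard := by
    intro n
    rw [hcount, hcount]
    exact ncard_lt_succ _ _ n ((finite_tripleDegree_lt _ (n + 1)).subset fun m hm => hm.2)
  rw [← ncard_singularHermitian_succ hσ hfix hcard P, hsucc (P + 1), hsucc P]
  push_cast
  ring

/-- For the quadric surface `X ⊂ ℙ³` over `𝔽_q` (`q` odd) defined by a diagonal form
with `a₁a₂a₃a₄` not a square in `𝔽_q^×`, the number of morphisms `ℙ¹ → X` of degree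
exactly `P ≥ 1` equals `(q⁴-1)/q²·q^{2P}` if `P` is even, and `0` if `P` is odd. -/
theorem mor_count_four_nonsquare (Fq : Type) [Field Fq] [Fintype Fq]
    (hchar : ringChar Fq ≠ 2)
    (a : Fin 4 → Fq) (ha : ∀ i, a i ≠ 0) (hsq : ¬ IsSquare (∏ i, a i))
    (P : ℕ) (hP : 1 ≤ P) :
    morCount a P =
      if Even P then
        ((Fintype.card Fq : ℚ) ^ 4 - 1) / (Fintype.card Fq : ℚ) ^ 2 *
          (Fintype.card Fq : ℚ) ^ (2 * P)
      else 0 := by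
  obtain ⟨P, rfl⟩ := Nat.exists_eq_add_of_le' hP
  have h2 : (2 : Fq) ≠ 0 := Ring.two_ne_zero hchar
  have h := diagCount_succ_sub_eq h2 hsq P
  rw [Nat.card_eq_fintype_card] at h
  have hq : (1 : ℚ) < Fintype.card Fq := by exact_mod_cast Fintype.one_lt_card
  have hq1 : (Fintype.card Fq : ℚ) - 1 ≠ 0 := by linarith
  have hq0 : (Fintype.card Fq : ℚ) ≠ 0 := by linarith
  simp only [morCount, diagCount_eq_normalForm hchar ha, add_tsub_cancel_right]
  rw [div_eq_iff hq1]
  split_ifs at h ⊢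
  · rw [mul_add, mul_one, pow_add]
    field_simp
    linear_combination h
  · linear_combination h
end

section
/- Let n ≥ 5 be odd, q a power of an odd prime, and X ⊂ ℙ^{n−1} the quadric defined by a diagonal form f = a₁X₁²+⋯+a_nX_n² over 𝔽_q. Then the number of morphisms ℙ¹ → X of degree P over 𝔽_q equals (q^{n−1}−1)(q^{n−2}−1)/(q^{n−2}(q−1)) · q^{P(n−2)} if P is even, and equals the same main term minus (q^{n−1}−1)/q^{(n−1)/2} · q^{((n−1)/2)P} if P is odd. -/
open Polynomial

section PolynomialDegree

variable {F : Type} [Field F]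

theorem degree_mul_lt_natCast {p r : F[X]} {a b : ℕ} (hp : p.degree < (a : WithBot ℕ))
    (hr : r.degree < (b : WithBot ℕ)) : (p * r).degree < ((a + b : ℕ) : WithBot ℕ) := by
  by_cases hp0 : p = 0
  · simp [hp0]
  by_cases hr0 : r = 0
  · simp [hr0]
  rw [degree_mul, degree_eq_natDegree hp0, degree_eq_natDegree hr0] at *
  norm_cast at *
  omega

theorem degree_mul_lt_iff_of_degree_eq {z r : F[X]} {e b : ℕ} (hz : z.degree = (e : WithBot ℕ)) :
    (z * r).degree < ((e + b : ℕ) : WithBot ℕ) ↔ r.degree < (b : WithBot ℕ) := by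
  by_cases hr0 : r = 0
  · simp [hr0]
  rw [degree_mul, hz, degree_eq_natDegree hr0]
  norm_cast
  omega

theorem degree_sum_C_mul_lt {m d : ℕ} (c : Fin m → F) {p : Fin m → F[X]}
    (hp : ∀ i, (p i).degree < (d : WithBot ℕ)) :
    (∑ i, C (c i) * p i).degree < (d : WithBot ℕ) := by
  rw [← mem_degreeLT]
  refine Submodule.sum_mem _ fun i _ => ?_
  rw [← smul_eq_C_mul]
  exact Submodule.smul_mem _ _ (mem_degreeLT.2 (hp i))

theorem degree_lt_of_le {p : F[X]} {a b : ℕ} (h : p.degree < (a : WithBot ℕ)) (hab : a ≤ b) :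
    p.degree < (b : WithBot ℕ) :=
  h.trans_le (by exact_mod_cast hab)

theorem degree_add_lt {p r : F[X]} {a : ℕ} (hp : p.degree < (a : WithBot ℕ))
    (hr : r.degree < (a : WithBot ℕ)) : (p + r).degree < (a : WithBot ℕ) :=
  (degree_add_le p r).trans_lt (max_lt hp hr)

theorem ne_zero_of_degree_eq_natCast {z : F[X]} {e : ℕ} (hz : z.degree = (e : WithBot ℕ)) :
    z ≠ 0 := by
  rintro rfl
  simp at hz

theorem mul_add_mod_of_degree_lt {z u w : F[X]} (hz : z ≠ 0) (hw : w.degree < z.degree) :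
    (z * u + w) % z = w := by
  rw [add_mod, EuclideanDomain.mod_eq_zero.2 (dvd_mul_right z u), zero_add,
    (mod_eq_self_iff hz).2 hw]

theorem mul_add_inj_of_degree_lt {z u u' w w' : F[X]} (hz : z ≠ 0) (hw : w.degree < z.degree)
    (hw' : w'.degree < z.degree) (h : z * u + w = z * u' + w') : u = u' ∧ w = w' := by
  have hww : w = w' := by
    rw [← mul_add_mod_of_degree_lt hz hw (u := u), h, mul_add_mod_of_degree_lt hz hw']
  subst hww
  exact ⟨mul_left_cancel₀ hz (add_right_cancel h), rfl⟩

theorem finite_degree_lt_s19 [Finite F] (d : ℕ) : {p : F[X] | p.degree < (d : WithBot ℕ)}.Finite := by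
  have : Finite (degreeLT F d) := Finite.of_equiv _ (degreeLTEquiv F d).symm.toEquiv
  refine (Set.toFinite (degreeLT F d : Set F[X])).subset fun p hp => ?_
  exact mem_degreeLT.2 hp

theorem card_degree_lt [Fintype F] (d : ℕ) :
    Nat.card {p : F[X] // p.degree < (d : WithBot ℕ)} = Fintype.card F ^ d := by
  have h : Nat.card (degreeLT F d) = Fintype.card F ^ d := by
    rw [Nat.card_congr (degreeLTEquiv F d).toEquiv]
    simp
  rw [← h]
  exact Nat.card_congr (Equiv.subtypeEquivRight fun p => mem_degreeLT.symm)

theorem card_vector_degree_lt [Fintype F] (m d : ℕ) :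
    Nat.card {w : Fin m → F[X] // ∀ i, (w i).degree < (d : WithBot ℕ)} =
      (Fintype.card F ^ m) ^ d := by
  rw [Nat.card_congr (Equiv.subtypePiEquivPi (p := fun _ (p : F[X]) => p.degree < (d : WithBot ℕ))),
    Nat.card_pi]
  simp [card_degree_lt, ← pow_mul, mul_comm]

theorem finite_vector_degree_lt [Finite F] (m d : ℕ) :
    {w : Fin m → F[X] | ∀ i, (w i).degree < (d : WithBot ℕ)}.Finite :=
  Set.Finite.pi' fun _ => finite_degree_lt_s19 d

end PolynomialDegree

section Forms

variable {F : Type} [Field F] {m : ℕ}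

/-- The diagonal quadratic form `∑ bᵢ wᵢ²` on vectors of polynomials. -/
noncomputable def diagForm (b : Fin m → F) (w : Fin m → F[X]) : F[X] :=
  ∑ i, C (b i) * w i ^ 2

/-- The polar form of `diagForm b`. -/
noncomputable def diagPolar (b : Fin m → F) (u w : Fin m → F[X]) : F[X] :=
  2 * ∑ i, C (b i) * (u i * w i)

theorem diagForm_mul_add (b : Fin m → F) (z : F[X]) (u w : Fin m → F[X]) :
    diagForm b (fun i => z * u i + w i) =
      z * (z * diagForm b u + diagPolar b u w) + diagForm b w := by
  simp only [diagForm, diagPolar, Finset.mul_sum, ← Finset.sum_add_distrib]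
  exact Finset.sum_congr rfl fun i _ => by ring

theorem degree_diagForm_lt (b : Fin m → F) {w : Fin m → F[X]} {d : ℕ}
    (hw : ∀ i, (w i).degree < (d : WithBot ℕ)) :
    (diagForm b w).degree < ((d + d : ℕ) : WithBot ℕ) :=
  degree_sum_C_mul_lt b fun i => by
    rw [pow_two]
    exact degree_mul_lt_natCast (hw i) (hw i)

theorem degree_diagPolar_lt (b : Fin m → F) {u w : Fin m → F[X]} {d e : ℕ}
    (hu : ∀ i, (u i).degree < (d : WithBot ℕ)) (hw : ∀ i, (w i).degree < (e : WithBot ℕ)) :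
    (diagPolar b u w).degree < ((d + e : ℕ) : WithBot ℕ) := by
  have h := degree_sum_C_mul_lt b fun i => degree_mul_lt_natCast (hu i) (hw i)
  rw [diagPolar, two_mul]
  exact degree_add_lt h h

end Forms

section Reduction

variable {F : Type} [Field F] {m : ℕ}

/-- Solutions `(z, w, y)` of `z y + ∑ bᵢ wᵢ² = 0` with `deg z, deg wᵢ < d` and `deg y < D`. -/
def hyperbolicSolutions (b : Fin m → F) (d D : ℕ) : Set (F[X] × (Fin m → F[X]) × F[X]) :=
  {t | t.1.degree < (d : WithBot ℕ) ∧ (∀ i, (t.2.1 i).degree < (d : WithBot ℕ)) ∧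
    t.2.2.degree < (D : WithBot ℕ) ∧ t.1 * t.2.2 + diagForm b t.2.1 = 0}

/-- Solutions `(z, w, y)` of `z y + ∑ bᵢ wᵢ² = 0` with `deg z = e`, `deg wᵢ < d` and
`deg y < D`. -/
def exactSolutions (b : Fin m → F) (e d D : ℕ) : Set (F[X] × (Fin m → F[X]) × F[X]) :=
  {t | t.1.degree = (e : WithBot ℕ) ∧ (∀ i, (t.2.1 i).degree < (d : WithBot ℕ)) ∧
    t.2.2.degree < (D : WithBot ℕ) ∧ t.1 * t.2.2 + diagForm b t.2.1 = 0}

/-- Pairs `(z, w)` with `deg z = e`, `w` reduced modulo `z`, and `z ∣ ∑ bᵢ wᵢ²`. -/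
def divisorPairs (b : Fin m → F) (e : ℕ) : Set (F[X] × (Fin m → F[X])) :=
  {t | t.1.degree = (e : WithBot ℕ) ∧ (∀ i, (t.2 i).degree < (e : WithBot ℕ)) ∧
    t.1 ∣ diagForm b t.2}

/-- Vectors `u` with `deg uᵢ < k` and `deg ∑ bᵢ uᵢ² < j`. -/
def lowDegreeVectors (b : Fin m → F) (k j : ℕ) : Set (Fin m → F[X]) :=
  {u | (∀ i, (u i).degree < (k : WithBot ℕ)) ∧ (diagForm b u).degree < (j : WithBot ℕ)}

theorem finite_hyperbolicSolutions [Finite F] (b : Fin m → F) (d D : ℕ) :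
    (hyperbolicSolutions b d D).Finite :=
  ((finite_degree_lt_s19 d).prod ((finite_vector_degree_lt m d).prod (finite_degree_lt_s19 D))).subset
    fun _ h => ⟨h.1, h.2.1, h.2.2.1⟩

theorem exactSolutions_remainder_iff (b : Fin m → F) {e k j : ℕ} (hkj : k ≤ j) {z r y : F[X]}
    {u w : Fin m → F[X]} (hz : z.degree = (e : WithBot ℕ))
    (hw : ∀ i, (w i).degree < (e : WithBot ℕ)) (hu : ∀ i, (u i).degree < (k : WithBot ℕ))
    (hr : diagForm b w = z * r) (hy : y = -(z * diagForm b u + diagPolar b u w + r)) :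
    y.degree < ((e + j : ℕ) : WithBot ℕ) ↔ (diagForm b u).degree < (j : WithBot ℕ) := by
  have hr' : r.degree < ((e + j : ℕ) : WithBot ℕ) := by
    have := degree_diagForm_lt b hw
    rw [hr, degree_mul_lt_iff_of_degree_eq hz] at this
    exact degree_lt_of_le this (Nat.le_add_right e j)
  have hp : (diagPolar b u w).degree < ((e + j : ℕ) : WithBot ℕ) :=
    degree_lt_of_le (degree_diagPolar_lt b hu hw) (by omega)
  have hs := degree_add_lt hp hr'
  rw [← degree_mul_lt_iff_of_degree_eq hz (r := diagForm b u)]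
  constructor
  · intro h
    have := degree_add_lt h hs
    have hzu : z * diagForm b u = -(y + (diagPolar b u w + r)) := by
      rw [hy]
      ring
    rwa [hzu, degree_neg]
  · intro h
    rw [hy, degree_neg, add_assoc]
    exact degree_add_lt h hs

theorem card_exactSolutions (b : Fin m → F) (e : ℕ) {k j : ℕ} (hkj : k ≤ j) :
    Nat.card (exactSolutions b e (e + k) (e + j)) =
      Nat.card (divisorPairs b e) * Nat.card (lowDegreeVectors b k j) := by
  rw [← Nat.card_prod]
  symm
  have hq : ∀ p : divisorPairs b e, ∃ r, diagForm b p.1.2 = p.1.1 * r := fun p => p.2.2.2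
  choose r hr using hq
  let f : divisorPairs b e × lowDegreeVectors b k j → exactSolutions b e (e + k) (e + j) :=
    fun p => ⟨(p.1.1.1, fun i => p.1.1.1 * p.2.1 i + p.1.1.2 i,
      -(p.1.1.1 * diagForm b p.2.1 + diagPolar b p.2.1 p.1.1.2 + r p.1)),
      p.1.2.1, fun i => degree_add_lt
        ((degree_mul_lt_iff_of_degree_eq p.1.2.1).2 (p.2.2.1 i))
        (degree_lt_of_le (p.1.2.2.1 i) (Nat.le_add_right e k)),
      (exactSolutions_remainder_iff b hkj p.1.2.1 p.1.2.2.1 p.2.2.1 (hr p.1) rfl).2 p.2.2.2, by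
        change p.1.1.1 * _ + diagForm b _ = 0
        rw [diagForm_mul_add, hr p.1]
        ring⟩
  refine Nat.card_congr (Equiv.ofBijective f ⟨?_, ?_⟩)
  · rintro ⟨⟨⟨z, w⟩, hz⟩, ⟨u, hu⟩⟩ ⟨⟨⟨z', w'⟩, hz'⟩, ⟨u', hu'⟩⟩ h
    have h1 : z = z' := congrArg (fun t => t.1.1) h
    subst h1
    have h2 : ∀ i, z * u i + w i = z * u' i + w' i := fun i => congrArg (fun t => t.1.2.1 i) h
    have h3 := fun i => mul_add_inj_of_degree_lt (ne_zero_of_degree_eq_natCast hz.1)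
      ((hz.2.1 i).trans_eq hz.1.symm) ((hz'.2.1 i).trans_eq hz.1.symm) (h2 i)
    obtain rfl : u = u' := funext fun i => (h3 i).1
    obtain rfl : w = w' := funext fun i => (h3 i).2
    rfl
  · rintro ⟨⟨z, v, y⟩, hz, hv, hy, he⟩
    change z.degree = _ at hz
    change ∀ i, (v i).degree < _ at hv
    change y.degree < _ at hy
    change z * y + diagForm b v = 0 at he
    have hz0 := ne_zero_of_degree_eq_natCast hz
    have hvd : ∀ i, z * (v i / z) + v i % z = v i := fun i => EuclideanDomain.div_add_mod _ _
    have hw : ∀ i, (v i % z).degree < (e : WithBot ℕ) := fun i =>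
      (degree_mod_lt _ hz0).trans_eq hz
    have hu : ∀ i, (v i / z).degree < (k : WithBot ℕ) := fun i => by
      rw [← degree_mul_lt_iff_of_degree_eq hz]
      have h := degree_add_lt (hv i)
        (degree_lt_of_le (by rw [degree_neg]; exact hw i : (-(v i % z)).degree < _)
          (Nat.le_add_right e k))
      convert h using 2
      linear_combination hvd i
    have hform : diagForm b v = z * (z * diagForm b (fun i => v i / z) +
        diagPolar b (fun i => v i / z) (fun i => v i % z)) + diagForm b (fun i => v i % z) := by
      rw [← diagForm_mul_add]
      exact congrArg _ (funext fun i => (hvd i).symm)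
    have hdvd : z ∣ diagForm b (fun i => v i % z) :=
      ⟨-(y + z * diagForm b (fun i => v i / z) +
        diagPolar b (fun i => v i / z) (fun i => v i % z)), by
        linear_combination he - hform⟩
    let p : divisorPairs b e := ⟨(z, fun i => v i % z), hz, hw, hdvd⟩
    have hyr : y = -(z * diagForm b (fun i => v i / z) +
        diagPolar b (fun i => v i / z) (fun i => v i % z) + r p) := by
      refine mul_left_cancel₀ hz0 ?_
      have := hr p
      change diagForm b (fun i => v i % z) = z * r p at this
      linear_combination he - hform - this
    refine ⟨(p, ⟨fun i => v i / z, hu,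
      (exactSolutions_remainder_iff b hkj hz hw hu (hr p) hyr).1 hy⟩), ?_⟩
    refine Subtype.ext (Prod.ext rfl (Prod.ext (funext hvd) hyr.symm))

theorem card_hyperbolicSolutions_zero [Fintype F] (b : Fin m → F) (d D : ℕ) :
    Nat.card {t : hyperbolicSolutions b d D // t.1.1 = 0} =
      diagCount b d * Fintype.card F ^ D := by
  rw [diagCount, ← card_degree_lt, ← Nat.card_prod]
  refine Nat.card_congr
    { toFun := fun t => (⟨t.1.1.2.1, t.1.2.2.1, ?_⟩, ⟨t.1.1.2.2, t.1.2.2.2.1⟩)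
      invFun := fun p => ⟨⟨(0, p.1.1, p.2.1), ?_, p.1.2.1, p.2.2, ?_⟩, rfl⟩
      left_inv := ?_
      right_inv := fun p => rfl }
  · have h := t.1.2.2.2.2
    rw [t.2, zero_mul, zero_add] at h
    exact h
  · simp
  · change 0 * _ + diagForm b p.1.1 = 0
    rw [zero_mul, zero_add]
    exact p.1.2.2
  · exact fun t => Subtype.ext (Subtype.ext (Prod.ext t.2.symm rfl))

theorem card_hyperbolicSolutions_ne_zero [Fintype F] (b : Fin m → F) (d D : ℕ) :
    Nat.card {t : hyperbolicSolutions b d D // t.1.1 ≠ 0} =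
      ∑ e ∈ Finset.range d, Nat.card (exactSolutions b e d D) := by
  have hfin := (finite_hyperbolicSolutions b d D).to_subtype
  have hdeg : ∀ t : {t : hyperbolicSolutions b d D // t.1.1 ≠ 0}, t.1.1.1.natDegree < d :=
    fun t => (natDegree_lt_iff_degree_lt t.2).2 t.1.2.1
  let f : {t : hyperbolicSolutions b d D // t.1.1 ≠ 0} → Fin d :=
    fun t => ⟨t.1.1.1.natDegree, hdeg t⟩
  rw [Nat.card_congr (Equiv.sigmaFiberEquiv f).symm, Nat.card_sigma,
    Finset.sum_range fun e => Nat.card (exactSolutions b e d D)]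
  refine Finset.sum_congr rfl fun e _ => Nat.card_congr
    { toFun := fun t => ⟨t.1.1.1, ?_, t.1.1.2.2⟩
      invFun := fun t => ⟨⟨⟨t.1, ?_, t.2.2⟩, ne_zero_of_degree_eq_natCast t.2.1⟩, ?_⟩
      left_inv := fun t => rfl
      right_inv := fun t => rfl }
  · rw [degree_eq_natDegree t.1.2]
    exact congrArg Nat.cast (congrArg Fin.val t.2)
  · rw [t.2.1]
    exact_mod_cast e.2
  · exact Fin.ext (natDegree_eq_of_degree_eq_some t.2.1)

theorem card_hyperbolicSolutions [Fintype F] (b : Fin m → F) {d D : ℕ} (hdD : d ≤ D) :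
    Nat.card (hyperbolicSolutions b d D) = diagCount b d * Fintype.card F ^ D +
      ∑ e ∈ Finset.range d, Nat.card (divisorPairs b e) *
        Nat.card (lowDegreeVectors b (d - e) (D - e)) := by
  classical
  have hfin := (finite_hyperbolicSolutions b d D).to_subtype
  rw [← Nat.card_congr (Equiv.sumCompl fun t : hyperbolicSolutions b d D => t.1.1 = 0),
    Nat.card_sum, card_hyperbolicSolutions_zero, card_hyperbolicSolutions_ne_zero]
  refine congrArg _ (Finset.sum_congr rfl fun e he => ?_)
  have he' := Finset.mem_range.1 he
  rw [← card_exactSolutions b e (by omega : d - e ≤ D - e)]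
  congr 3 <;> omega

theorem card_hyperbolicSolutions_succ [Fintype F] (b : Fin m → F) (d : ℕ) :
    Nat.card (hyperbolicSolutions b d (d + 1)) =
      Nat.card (hyperbolicSolutions b d d) + Nat.card (divisorPairs b d) := by
  classical
  have hfin := (finite_hyperbolicSolutions b d (d + 1)).to_subtype
  rw [← Nat.card_congr (Equiv.sumCompl fun t : hyperbolicSolutions b d (d + 1) =>
    t.1.2.2.degree < (d : WithBot ℕ)), Nat.card_sum]
  congr 1
  · refine Nat.card_congr
      { toFun := fun t => ⟨t.1.1, t.1.2.1, t.1.2.2.1, t.2, t.1.2.2.2.2⟩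
        invFun := fun t => ⟨⟨t.1, t.2.1, t.2.2.1,
          degree_lt_of_le t.2.2.2.1 (Nat.le_succ d), t.2.2.2.2⟩, t.2.2.2.1⟩
        left_inv := fun t => rfl
        right_inv := fun t => rfl }
  · have hd : ∀ t : {t : hyperbolicSolutions b d (d + 1) // ¬ t.1.2.2.degree < (d : WithBot ℕ)},
        t.1.1.2.2.degree = (d : WithBot ℕ) := by
      rintro ⟨⟨⟨z, w, y⟩, -, -, hy, -⟩, h⟩
      change y.degree = _
      change y.degree < _ at hy
      change ¬ y.degree < _ at h
      have hy0 : y ≠ 0 := by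
        rintro rfl
        simp at h
      rw [degree_eq_natDegree hy0] at *
      norm_cast at *
      omega
    let f : {t : hyperbolicSolutions b d (d + 1) // ¬ t.1.2.2.degree < (d : WithBot ℕ)} →
        divisorPairs b d := fun t => ⟨(t.1.1.2.2, t.1.1.2.1), hd t, t.1.2.2.1,
      ⟨-t.1.1.1, by
        change diagForm b _ = _ * _
        linear_combination t.1.2.2.2.2⟩⟩
    refine Nat.card_congr (Equiv.ofBijective f ⟨?_, ?_⟩)
    · intro s t h
      have h1 : s.1.1.2.2 = t.1.1.2.2 := congrArg (fun p => p.1.1) h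
      have h2 : s.1.1.2.1 = t.1.1.2.1 := congrArg (fun p => p.1.2) h
      have h3 : s.1.1.1 = t.1.1.1 := by
        refine mul_right_cancel₀ (ne_zero_of_degree_eq_natCast (hd s)) ?_
        have hs := s.1.2.2.2.2
        have ht := t.1.2.2.2.2
        rw [h2] at hs
        rw [← h1] at ht
        linear_combination hs - ht
      exact Subtype.ext (Subtype.ext (Prod.ext h3 (Prod.ext h2 h1)))
    · rintro ⟨⟨y, w⟩, hy, hw, r, hr⟩
      change diagForm b w = y * r at hr
      change y.degree = _ at hy
      have hrd : r.degree < (d : WithBot ℕ) := by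
        rw [← degree_mul_lt_iff_of_degree_eq hy, ← hr]
        exact degree_diagForm_lt b hw
      refine ⟨⟨⟨(-r, w, y), by rwa [degree_neg], hw, ?_, ?_⟩, ?_⟩, rfl⟩
      · change y.degree < _
        rw [hy]
        exact_mod_cast Nat.lt_succ_self d
      · change -r * y + diagForm b w = 0
        rw [hr]
        ring
      · change ¬ y.degree < _
        rw [hy]
        exact lt_irrefl _

end Reduction

section LocalDensity

variable {F : Type} [Field F] {m : ℕ}

/-- Vectors `v` with `deg vᵢ < k` and `t ^ j ∣ ∑ bᵢ vᵢ²`. -/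
def dvdVectors (b : Fin m → F) (k j : ℕ) : Set (Fin m → F[X]) :=
  {v | (∀ i, (v i).degree < (k : WithBot ℕ)) ∧ X ^ j ∣ diagForm b v}

theorem finite_dvdVectors [Finite F] (b : Fin m → F) (k j : ℕ) : (dvdVectors b k j).Finite :=
  (finite_vector_degree_lt m k).subset fun _ h => h.1

theorem degree_reflect_lt {p : F[X]} {N : ℕ} (hp : p.degree < ((N + 1 : ℕ) : WithBot ℕ)) :
    (reflect N p).degree < ((N + 1 : ℕ) : WithBot ℕ) := by
  rw [degree_lt_iff_coeff_zero] at *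
  intro i hi
  rw [coeff_reflect, revAt_eq_self_of_lt (by omega)]
  exact hp i hi

theorem reflect_diagForm (b : Fin m → F) {w : Fin m → F[X]} {N : ℕ}
    (hw : ∀ i, (w i).degree < ((N + 1 : ℕ) : WithBot ℕ)) :
    reflect (N + N) (diagForm b w) = diagForm b fun i => reflect N (w i) := by
  have h := map_sum (⟨⟨reflect (N + N), reflect_zero⟩, fun p r => reflect_add p r _⟩ :
    F[X] →+ F[X]) (fun i => C (b i) * w i ^ 2) Finset.univ
  refine h.trans (Finset.sum_congr rfl fun i _ => ?_)
  have hi : (w i).natDegree ≤ N := by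
    rw [natDegree_le_iff_coeff_eq_zero]
    exact fun n hn => (degree_lt_iff_coeff_zero _ _).1 (hw i) n hn
  change reflect (N + N) (C (b i) * w i ^ 2) = _
  rw [reflect_C_mul, pow_two, pow_two, reflect_mul _ _ hi hi]

theorem X_pow_dvd_reflect_iff {p : F[X]} {N j : ℕ}
    (hp : p.degree < ((N + 1 : ℕ) : WithBot ℕ)) :
    X ^ (N + 1 - j) ∣ reflect N p ↔ p.degree < (j : WithBot ℕ) := by
  rw [X_pow_dvd_iff, degree_lt_iff_coeff_zero]
  rw [degree_lt_iff_coeff_zero] at hp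
  constructor
  · intro h n hn
    by_cases hnN : n ≤ N
    · have := h (N - n) (by omega)
      rwa [coeff_reflect, revAt_le (by omega), Nat.sub_sub_self hnN] at this
    · exact hp n (by omega)
  · intro h d hd
    rw [coeff_reflect, revAt_le (by omega)]
    exact h _ (by omega)

theorem card_lowDegreeVectors (b : Fin m → F) (N j : ℕ) :
    Nat.card (lowDegreeVectors b (N + 1) j) =
      Nat.card (dvdVectors b (N + 1) (N + N + 1 - j)) := by
  have hrr : ∀ u : Fin m → F[X], (fun i => reflect N (reflect N (u i))) = u := fun u =>
    funext fun i => reflect_reflect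
  have hlt : ∀ u : Fin m → F[X], (∀ i, (u i).degree < ((N + 1 : ℕ) : WithBot ℕ)) →
      (diagForm b u).degree < ((N + N + 1 : ℕ) : WithBot ℕ) := fun u hu =>
    degree_sum_C_mul_lt b fun i => by
      rw [pow_two]
      by_cases h0 : u i = 0
      · simp [h0]
      have := hu i
      rw [degree_mul, degree_eq_natDegree h0] at *
      norm_cast at *
      omega
  refine Nat.card_congr
    { toFun := fun u => ⟨fun i => reflect N (u.1 i), fun i => degree_reflect_lt (u.2.1 i), ?_⟩
      invFun := fun v => ⟨fun i => reflect N (v.1 i), fun i => degree_reflect_lt (v.2.1 i), ?_⟩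
      left_inv := fun u => Subtype.ext (hrr u.1)
      right_inv := fun v => Subtype.ext (hrr v.1) }
  · rw [← reflect_diagForm b u.2.1, X_pow_dvd_reflect_iff (hlt _ u.2.1)]
    exact u.2.2
  · have hv := v.2.2
    have hd : ∀ i, (reflect N (v.1 i)).degree < ((N + 1 : ℕ) : WithBot ℕ) :=
      fun i => degree_reflect_lt (v.2.1 i)
    rw [← X_pow_dvd_reflect_iff (hlt _ hd), reflect_diagForm b hd, hrr]
    exact hv

theorem card_dvdVectors_add [Fintype F] (b : Fin m → F) (j l : ℕ) :
    Nat.card (dvdVectors b (j + l) j) =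
      Nat.card (dvdVectors b j j) * (Fintype.card F ^ m) ^ l := by
  rw [← card_vector_degree_lt m l, ← Nat.card_prod]
  symm
  have hX : (X ^ j : F[X]).degree = (j : WithBot ℕ) := degree_X_pow j
  have hdvd : ∀ u w : Fin m → F[X],
      X ^ j ∣ diagForm b (fun i => X ^ j * u i + w i) ↔ X ^ j ∣ diagForm b w := fun u w => by
    rw [diagForm_mul_add, dvd_add_right (dvd_mul_right _ _)]
  let f : dvdVectors b j j × {u : Fin m → F[X] // ∀ i, (u i).degree < (l : WithBot ℕ)} →
      dvdVectors b (j + l) j := fun p => ⟨fun i => X ^ j * p.2.1 i + p.1.1 i,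
    fun i => degree_add_lt ((degree_mul_lt_iff_of_degree_eq hX).2 (p.2.2 i))
      (degree_lt_of_le (p.1.2.1 i) (Nat.le_add_right j l)), (hdvd _ _).2 p.1.2.2⟩
  refine Nat.card_congr (Equiv.ofBijective f ⟨?_, ?_⟩)
  · rintro ⟨⟨w, hw⟩, ⟨u, hu⟩⟩ ⟨⟨w', hw'⟩, ⟨u', hu'⟩⟩ h
    have h2 : ∀ i, X ^ j * u i + w i = X ^ j * u' i + w' i := fun i =>
      congrArg (fun t => t.1 i) h
    have h3 := fun i => mul_add_inj_of_degree_lt (ne_zero_of_degree_eq_natCast hX)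
      ((hw.1 i).trans_eq hX.symm) ((hw'.1 i).trans_eq hX.symm) (h2 i)
    obtain rfl : u = u' := funext fun i => (h3 i).1
    obtain rfl : w = w' := funext fun i => (h3 i).2
    rfl
  · rintro ⟨v, hv, hdv⟩
    have hvd : (fun i => X ^ j * (v i / X ^ j) + v i % X ^ j) = v :=
      funext fun i => EuclideanDomain.div_add_mod _ _
    have hw : ∀ i, (v i % X ^ j).degree < (j : WithBot ℕ) := fun i =>
      (degree_mod_lt _ (ne_zero_of_degree_eq_natCast hX)).trans_eq hX
    have hu : ∀ i, (v i / X ^ j).degree < (l : WithBot ℕ) := fun i => by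
      rw [← degree_mul_lt_iff_of_degree_eq hX]
      have h := degree_add_lt (hv i)
        (degree_lt_of_le (by rw [degree_neg]; exact hw i : (-(v i % X ^ j)).degree < _)
          (Nat.le_add_right j l))
      convert h using 2
      linear_combination congrFun hvd i
    refine ⟨(⟨fun i => v i % X ^ j, hw, ?_⟩, ⟨fun i => v i / X ^ j, hu⟩), Subtype.ext hvd⟩
    rw [← hdvd (fun i => v i / X ^ j), hvd]
    exact hdv

theorem isCoprime_X_of_coeff_zero_ne_zero {p : F[X]} (hp : p.coeff 0 ≠ 0) :
    IsCoprime (X : F[X]) p :=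
  (irreducible_X.coprime_iff_not_dvd).2 fun h => hp (X_dvd_iff.1 h)

/-- Vectors of polynomials of degree less than `j`. -/
abbrev BoundedVector (F : Type) [Field F] (m j : ℕ) : Type :=
  {v : Fin m → F[X] // ∀ i, (v i).degree < (j : WithBot ℕ)}

theorem card_boundedVector_apply_eq_zero [Fintype F] (j : ℕ) (i₀ : Fin m) :
    Nat.card {v : BoundedVector F m j // v.1 i₀ = 0} = (Fintype.card F ^ (m - 1)) ^ j := by
  classical
  have hupd : ∀ (v : BoundedVector F m j) (p : {p : F[X] // p.degree < (j : WithBot ℕ)}) (i),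
      (Function.update v.1 i₀ p.1 i).degree < (j : WithBot ℕ) := by
    intro v p i
    by_cases hi : i = i₀
    · subst hi
      simpa using p.2
    · simpa [hi] using v.2 i
  have e : Nat.card ({v : BoundedVector F m j // v.1 i₀ = 0} ×
      {p : F[X] // p.degree < (j : WithBot ℕ)}) = Nat.card (BoundedVector F m j) := by
    refine Nat.card_congr
      { toFun := fun t => ⟨Function.update t.1.1.1 i₀ t.2.1, hupd t.1.1 t.2⟩
        invFun := fun v => (⟨⟨Function.update v.1 i₀ 0, hupd v ⟨0, by simp⟩⟩, by simp⟩,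
          ⟨v.1 i₀, v.2 i₀⟩)
        left_inv := ?_
        right_inv := fun v => Subtype.ext (by simp) }
    rintro ⟨⟨v, hv⟩, p⟩
    refine Prod.ext (Subtype.ext (Subtype.ext ?_)) (Subtype.ext (by simp))
    simp [← hv]
  rw [Nat.card_prod, card_degree_lt, card_vector_degree_lt] at e
  have hm : m = m - 1 + 1 := by
    have := i₀.2
    omega
  have hq : Fintype.card F ^ j ≠ 0 := pow_ne_zero _ Fintype.card_ne_zero
  refine Nat.eq_of_mul_eq_mul_right (Nat.pos_of_ne_zero hq) (e.trans ?_)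
  rw [← mul_pow, ← pow_succ, ← hm]

theorem card_lifts_of_ne_zero [Fintype F] (h2 : (2 : F) ≠ 0) {b : Fin m → F}
    (hb : ∀ i, b i ≠ 0) {c : Fin m → F} (hc : c ≠ 0) (j : ℕ) :
    Nat.card {v : BoundedVector F m j //
      X ^ j ∣ X * diagForm b v.1 + diagPolar b v.1 fun i => C (c i)} =
      (Fintype.card F ^ (m - 1)) ^ j := by
  classical
  obtain ⟨i₀, hi₀⟩ := Function.ne_iff.1 hc
  have hX : (X ^ j : F[X]).degree = (j : WithBot ℕ) := degree_X_pow j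
  have hX0 := ne_zero_of_degree_eq_natCast hX
  let L : (Fin m → F[X]) → F[X] := fun v => X * diagForm b v + diagPolar b v fun i => C (c i)
  let Φ : BoundedVector F m j → BoundedVector F m j := fun v =>
    ⟨Function.update v.1 i₀ (L v.1 % X ^ j), fun i => by
      by_cases hi : i = i₀
      · subst hi
        simpa using (degree_mod_lt (L v.1) hX0).trans_eq hX
      · simpa [hi] using v.2 i⟩
  have hfin : Finite (BoundedVector F m j) := (finite_vector_degree_lt m j).to_subtype
  have hinj : Function.Injective Φ := by
    intro v w h
    have hoff : ∀ i, i ≠ i₀ → v.1 i = w.1 i := fun i hi => by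
      have := congrArg (fun t => t.1 i) h
      simpa [Φ, hi] using this
    have hon : L v.1 % X ^ j = L w.1 % X ^ j := by
      have := congrArg (fun t => t.1 i₀) h
      simpa [Φ] using this
    have hdvd : X ^ j ∣ L v.1 - L w.1 := by
      rw [← EuclideanDomain.mod_eq_zero, sub_mod, hon, sub_self]
    have hL : L v.1 - L w.1 = (v.1 i₀ - w.1 i₀) *
        (C (2 * (b i₀ * c i₀)) + X * (C (b i₀) * (v.1 i₀ + w.1 i₀))) := by
      have : L v.1 - L w.1 = ∑ i, (v.1 i - w.1 i) *
          (C (2 * (b i * c i)) + X * (C (b i) * (v.1 i + w.1 i))) := by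
        simp only [L, diagForm, diagPolar, Finset.mul_sum, ← Finset.sum_add_distrib,
          ← Finset.sum_sub_distrib]
        refine Finset.sum_congr rfl fun i _ => ?_
        simp only [map_mul, map_ofNat]
        ring
      rw [this]
      refine Finset.sum_eq_single i₀ (fun i _ hi => ?_) (by simp)
      rw [hoff i hi, sub_self, zero_mul]
    have hcop : IsCoprime (X ^ j : F[X])
        (C (2 * (b i₀ * c i₀)) + X * (C (b i₀) * (v.1 i₀ + w.1 i₀))) := by
      refine (isCoprime_X_of_coeff_zero_ne_zero ?_).pow_left
      simpa using ⟨h2, hb i₀, hi₀⟩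
    rw [hL] at hdvd
    have hz := eq_zero_of_dvd_of_degree_lt (hcop.dvd_of_dvd_mul_right hdvd) (by
      rw [hX, sub_eq_add_neg]
      exact degree_add_lt (v.2 i₀) (by rw [degree_neg]; exact w.2 i₀))
    refine Subtype.ext (funext fun i => ?_)
    by_cases hi : i = i₀
    · rw [hi]
      exact sub_eq_zero.1 hz
    · exact hoff i hi
  rw [← card_boundedVector_apply_eq_zero j i₀]
  refine Nat.card_congr (Equiv.subtypeEquiv
    (Equiv.ofBijective Φ (Finite.injective_iff_bijective.1 hinj)) fun v => ?_)
  rw [← EuclideanDomain.mod_eq_zero]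
  simp [Φ, L]

theorem card_dvdVectors_fiber (b : Fin m → F) (c : Fin m → F) (j : ℕ) :
    Nat.card {v : dvdVectors b (j + 1) (j + 1) // (fun i => (v.1 i).coeff 0) = c} =
      Nat.card {v : BoundedVector F m j //
        X ^ (j + 1) ∣ diagForm b fun i => X * v.1 i + C (c i)} := by
  have hX : (X : F[X]).degree = ((1 : ℕ) : WithBot ℕ) := degree_X
  symm
  let f : {v : BoundedVector F m j // X ^ (j + 1) ∣ diagForm b fun i => X * v.1 i + C (c i)} →
      {v : dvdVectors b (j + 1) (j + 1) // (fun i => (v.1 i).coeff 0) = c} := fun v =>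
    ⟨⟨fun i => X * v.1.1 i + C (c i), fun i => degree_add_lt
        (degree_lt_of_le ((degree_mul_lt_iff_of_degree_eq hX).2 (v.1.2 i)) (by omega))
        (degree_C_le.trans_lt (by exact_mod_cast j.succ_pos)), v.2⟩, funext fun i => by simp⟩
  refine Nat.card_congr (Equiv.ofBijective f ⟨?_, ?_⟩)
  · intro v w h
    refine Subtype.ext (Subtype.ext (funext fun i => ?_))
    have h1 : X * v.1.1 i + C (c i) = X * w.1.1 i + C (c i) := congrArg (fun t => t.1.1 i) h
    exact mul_left_cancel₀ X_ne_zero (add_right_cancel h1)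
  · rintro ⟨⟨v, hv, hd⟩, rfl⟩
    have hvd : (fun i => X * (v i).divX + C ((v i).coeff 0)) = v := funext fun i =>
      X_mul_divX_add (v i)
    refine ⟨⟨⟨fun i => (v i).divX, fun i => ?_⟩, ?_⟩, ?_⟩
    · rw [degree_lt_iff_coeff_zero]
      intro n hn
      rw [coeff_divX]
      exact (degree_lt_iff_coeff_zero _ _).1 (hv i) _ (by omega)
    · change X ^ (j + 1) ∣ diagForm b fun i => X * (v i).divX + C ((v i).coeff 0)
      rw [hvd]
      exact hd
    · exact Subtype.ext (Subtype.ext hvd)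

theorem diagForm_C (b c : Fin m → F) :
    (diagForm b fun i => C (c i)) = C (∑ i, b i * c i ^ 2) := by
  simp [diagForm, map_sum]

theorem card_dvdVectors_fiber_eq [Fintype F] (h2 : (2 : F) ≠ 0) {b : Fin m → F}
    (hb : ∀ i, b i ≠ 0) {c : Fin m → F} (hc : c ≠ 0) (j : ℕ) [Decidable (∑ i, b i * c i ^ 2 = 0)] :
    Nat.card {v : dvdVectors b (j + 1) (j + 1) // (fun i => (v.1 i).coeff 0) = c} =
      if ∑ i, b i * c i ^ 2 = 0 then (Fintype.card F ^ (m - 1)) ^ j else 0 := by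
  rw [card_dvdVectors_fiber]
  simp only [diagForm_mul_add, diagForm_C]
  split_ifs with h
  · rw [← card_lifts_of_ne_zero h2 hb hc j]
    simp only [h, map_zero, add_zero, pow_succ' X j, mul_dvd_mul_iff_left (X_ne_zero (R := F))]
  · rw [Nat.card_eq_zero]
    left
    refine ⟨fun v => h ?_⟩
    have h1 := (dvd_pow_self (X : F[X]) j.succ_ne_zero).trans v.2
    rw [dvd_add_right (dvd_mul_right _ _), X_dvd_iff, coeff_C_zero] at h1
    exact h1

theorem card_dvdVectors_fiber_zero_zero (b : Fin m → F) :
    Nat.card {v : dvdVectors b (0 + 1) (0 + 1) // (fun i => (v.1 i).coeff 0) = 0} = 1 := by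
  rw [card_dvdVectors_fiber, Nat.card_eq_one_iff_unique]
  refine ⟨⟨fun v w => Subtype.ext (Subtype.ext (funext fun i => ?_))⟩,
    ⟨⟨⟨0, fun i => by simp⟩, by simp [diagForm]⟩⟩⟩
  have hv := v.1.2 i
  have hw := w.1.2 i
  simp only [Nat.cast_zero, Nat.WithBot.lt_zero_iff, degree_eq_bot] at hv hw
  rw [hv, hw]

theorem card_dvdVectors_fiber_zero_succ [Fintype F] (b : Fin m → F) (j : ℕ) :
    Nat.card {v : dvdVectors b (j + 1 + 1) (j + 1 + 1) // (fun i => (v.1 i).coeff 0) = 0} =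
      Nat.card (dvdVectors b j j) * Fintype.card F ^ m := by
  have h := card_dvdVectors_add b j 1
  rw [pow_one] at h
  rw [card_dvdVectors_fiber, ← h]
  have hform : ∀ v : Fin m → F[X], (diagForm b fun i => X * v i + C ((0 : Fin m → F) i)) =
      X ^ 2 * diagForm b v := fun v => by
    rw [diagForm_mul_add]
    simp [diagForm, diagPolar]
    ring
  refine Nat.card_congr ((Equiv.subtypeEquivRight fun v => ?_).trans
    (Equiv.subtypeSubtypeEquivSubtypeInter _ fun v => X ^ j ∣ diagForm b v))
  rw [hform, show j + 1 + 1 = 2 + j by ring, pow_add X 2 j,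
    mul_dvd_mul_iff_left (pow_ne_zero 2 (X_ne_zero (R := F)))]

theorem diagCount_one [Fintype F] (b : Fin m → F) :
    diagCount b 1 = Nat.card {c : Fin m → F // ∑ i, b i * c i ^ 2 = 0} := by
  rw [diagCount]
  symm
  have hC : ∀ c : Fin m → F, ∑ i, C (b i) * C (c i) ^ 2 = C (∑ i, b i * c i ^ 2) := diagForm_C b
  refine Nat.card_congr (Equiv.ofBijective (fun c => ⟨fun i => C (c.1 i), fun i =>
    degree_C_le.trans_lt (by exact_mod_cast Nat.one_pos), by rw [hC, c.2, map_zero]⟩) ⟨?_, ?_⟩)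
  · intro c d h
    exact Subtype.ext (funext fun i => C_injective (congrArg (fun t => t.1 i) h))
  · rintro ⟨x, hx, h⟩
    have hxc : ∀ i, C ((x i).coeff 0) = x i := fun i =>
      (eq_C_of_degree_le_zero (Nat.WithBot.lt_one_iff_le_zero.1 (hx i))).symm
    refine ⟨⟨fun i => (x i).coeff 0, ?_⟩, Subtype.ext (funext hxc)⟩
    rw [← C_eq_zero (R := F), ← hC]
    simpa only [hxc] using h

theorem card_dvdVectors_succ [Fintype F] (h2 : (2 : F) ≠ 0) {b : Fin m → F}
    (hb : ∀ i, b i ≠ 0) (j : ℕ) :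
    (Nat.card (dvdVectors b (j + 1) (j + 1)) : ℚ) =
      Nat.card {v : dvdVectors b (j + 1) (j + 1) // (fun i => (v.1 i).coeff 0) = 0} +
        ((diagCount b 1 : ℚ) - 1) * ((Fintype.card F : ℚ) ^ (m - 1)) ^ j := by
  classical
  have hfin := (finite_dvdVectors b (j + 1) (j + 1)).to_subtype
  rw [Nat.card_congr (Equiv.sigmaFiberEquiv fun (v : dvdVectors b (j + 1) (j + 1)) =>
    (fun i => (v.1 i).coeff 0 : Fin m → F)).symm, Nat.card_sigma, Nat.cast_sum,
    ← Finset.add_sum_erase _ _ (Finset.mem_univ (0 : Fin m → F))]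
  congr 1
  have h : ∀ c ∈ Finset.univ.erase (0 : Fin m → F),
      (Nat.card {v : dvdVectors b (j + 1) (j + 1) // (fun i => (v.1 i).coeff 0) = c} : ℚ) =
      if ∑ i, b i * c i ^ 2 = 0 then ((Fintype.card F : ℚ) ^ (m - 1)) ^ j else 0 := by
    intro c hc
    rw [card_dvdVectors_fiber_eq h2 hb (Finset.ne_of_mem_erase hc)]
    split_ifs <;> simp
  rw [Finset.sum_congr rfl h, Finset.sum_erase_eq_sub (Finset.mem_univ _), diagCount_one,
    Nat.card_eq_fintype_card, Fintype.card_subtype, Finset.sum_ite]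
  simp [sub_mul]

theorem card_dvdVectors_zero (b : Fin m → F) : Nat.card (dvdVectors b 0 0) = 1 := by
  rw [Nat.card_eq_one_iff_unique]
  refine ⟨⟨fun v w => Subtype.ext (funext fun i => ?_)⟩, ⟨⟨0, fun i => by simp, by simp⟩⟩⟩
  have hv := v.2.1 i
  have hw := w.2.1 i
  simp only [Nat.cast_zero, Nat.WithBot.lt_zero_iff, degree_eq_bot] at hv hw
  rw [hv, hw]

end LocalDensity

section Isometry

variable {F : Type} [Field F] {m : ℕ}

/-- The form complementary to the hyperbolic plane split off from a diagonal form
whose first three coefficients are nonzero. -/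
noncomputable def splitCoeff (a : Fin (m + 1 + 1 + 1) → F) : Fin (m + 1) → F :=
  Fin.cons (-(a 0 * a 1 * a 2)) fun i => a i.succ.succ.succ

theorem splitCoeff_ne_zero {a : Fin (m + 1 + 1 + 1) → F} (ha : ∀ i, a i ≠ 0) (i : Fin (m + 1)) :
    splitCoeff a i ≠ 0 := by
  refine Fin.cases ?_ (fun i => ?_) i
  · simp [splitCoeff, ha]
  · simpa [splitCoeff] using ha _

theorem exists_sq_add_sq_eq_neg [Fintype F] (hF : ringChar F ≠ 2) {c d e : F} (hc : c ≠ 0)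
    (hd : d ≠ 0) : ∃ x y : F, c * x ^ 2 + d * y ^ 2 = -e := by
  obtain ⟨x, y, h⟩ := FiniteField.exists_root_sum_quadratic
    (f := C c * X ^ 2 + C 0 * X + C e) (g := C d * X ^ 2 + C 0 * X + C 0)
    (degree_quadratic hc) (degree_quadratic hd) (FiniteField.odd_card_of_char_ne_two hF)
  refine ⟨x, y, ?_⟩
  simp at h
  linear_combination h

theorem degree_C_mul_lt {p : F[X]} {d : ℕ} (c : F) (hp : p.degree < (d : WithBot ℕ)) :
    (C c * p).degree < (d : WithBot ℕ) := by
  rw [← mem_degreeLT, ← smul_eq_C_mul] at *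
  exact Submodule.smul_mem _ _ hp

theorem degree_C_mul_add_C_mul_lt_s19 {p r : F[X]} {d : ℕ} (c e : F)
    (hp : p.degree < (d : WithBot ℕ)) (hr : r.degree < (d : WithBot ℕ)) :
    (C c * p + C e * r).degree < (d : WithBot ℕ) :=
  degree_add_lt (degree_C_mul_lt c hp) (degree_C_mul_lt e hr)

theorem diagCount_eq_card_hyperbolicSolutions [Fintype F] (hF : ringChar F ≠ 2)
    {a : Fin (m + 1 + 1 + 1) → F} (ha : ∀ i, a i ≠ 0) (P : ℕ) :
    diagCount a P = Nat.card (hyperbolicSolutions (splitCoeff a) P P) := by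
  obtain ⟨α, β, h⟩ := exists_sq_add_sq_eq_neg hF (ha 1) (ha 2) (e := a 0)
  have h2 : (2 : F) ≠ 0 := Ring.two_ne_zero hF
  have h1 : C (a 1) * C α ^ 2 + C (a 2) * C β ^ 2 = -C (a 0) := by
    simpa using congrArg C h
  have hi : C (a 0) * C (a 0)⁻¹ = 1 := by rw [← C_mul, mul_inv_cancel₀ (ha 0), C_1]
  have hh : (2 : F[X]) * C 2⁻¹ = 1 := by
    rw [← C_ofNat, ← C_mul, mul_inv_cancel₀ h2, C_1]
  let fX : (Fin (m + 1 + 1 + 1) → F[X]) → F[X] := fun x =>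
    C (-(a 0)⁻¹ * (a 1 * α)) * x 1 + C (-(a 0)⁻¹ * (a 2 * β)) * x 2
  let fY : (Fin (m + 1 + 1 + 1) → F[X]) → F[X] := fun x =>
    C ((a 0)⁻¹ * β) * x 1 + C (-(a 0)⁻¹ * α) * x 2
  let f : (Fin (m + 1 + 1 + 1) → F[X]) → F[X] × (Fin (m + 1) → F[X]) × F[X] := fun x =>
    (C (a 0) * x 0 + C (-a 0) * fX x, Fin.cons (fY x) fun i => x i.succ.succ.succ,
      C 1 * x 0 + C 1 * fX x)
  let gX : F[X] × (Fin (m + 1) → F[X]) × F[X] → F[X] := fun t =>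
    C 2⁻¹ * t.2.2 + C (-(2⁻¹ * (a 0)⁻¹)) * t.1
  let g : F[X] × (Fin (m + 1) → F[X]) × F[X] → Fin (m + 1 + 1 + 1) → F[X] := fun t =>
    Fin.cons (C 2⁻¹ * t.2.2 + C (2⁻¹ * (a 0)⁻¹) * t.1)
      (Fin.cons (C α * gX t + C (-(a 2 * β)) * t.2.1 0)
        (Fin.cons (C β * gX t + C (a 1 * α) * t.2.1 0) fun i => t.2.1 i.succ))
  have hfX : ∀ x, fX x = -C (a 0)⁻¹ * (C (a 1) * C α * x 1 + C (a 2) * C β * x 2) := by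
    intro x
    simp only [fX, map_mul, map_neg]
    ring
  have hfY : ∀ x, fY x = C (a 0)⁻¹ * (C β * x 1 - C α * x 2) := by
    intro x
    simp only [fY, map_mul, map_neg]
    ring
  have hgX : ∀ x, gX (f x) = fX x := by
    intro x
    simp only [gX, f, map_mul, map_neg, C_1]
    linear_combination fX x * hh - C 2⁻¹ * (x 0 - fX x) * hi
  have hx1 : ∀ x, C α * fX x + C (-(a 2 * β)) * fY x = x 1 := by
    intro x
    rw [hfX, hfY]
    simp only [map_mul, map_neg]
    linear_combination -C (a 0)⁻¹ * x 1 * h1 + x 1 * hi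
  have hx2 : ∀ x, C β * fX x + C (a 1 * α) * fY x = x 2 := by
    intro x
    rw [hfX, hfY]
    simp only [map_mul]
    linear_combination -C (a 0)⁻¹ * x 2 * h1 + x 2 * hi
  have hgf : ∀ x, g (f x) = x := by
    intro x
    funext i
    refine Fin.cases ?_ (fun i => Fin.cases ?_ (fun i => Fin.cases ?_ (fun i => rfl) i) i) i
    · simp only [f, g, map_mul, map_neg, C_1, Fin.cons_zero]
      linear_combination x 0 * hh + C 2⁻¹ * (x 0 - fX x) * hi
    · change C α * gX (f x) + C (-(a 2 * β)) * fY x = x 1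
      rw [hgX, hx1]
    · change C β * gX (f x) + C (a 1 * α) * fY x = x 2
      rw [hgX, hx2]
  have hg1 : ∀ t, g t 1 = C α * gX t + C (-(a 2 * β)) * t.2.1 0 := fun t => rfl
  have hg2 : ∀ t, g t 2 = C β * gX t + C (a 1 * α) * t.2.1 0 := fun t => rfl
  have hfXg : ∀ t, fX (g t) = gX t := by
    intro t
    rw [hfX, hg1, hg2]
    simp only [map_mul, map_neg]
    linear_combination -C (a 0)⁻¹ * gX t * h1 + gX t * hi
  have hfYg : ∀ t, fY (g t) = t.2.1 0 := by
    intro t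
    rw [hfY, hg1, hg2]
    simp only [map_mul, map_neg]
    linear_combination -C (a 0)⁻¹ * t.2.1 0 * h1 + t.2.1 0 * hi
  have hfg : ∀ t, f (g t) = t := by
    intro t
    refine Prod.ext ?_ (Prod.ext (funext fun i => Fin.cases (hfYg t) (fun i => rfl) i) ?_)
    · simp only [f, hfXg]
      simp only [g, gX, map_mul, map_neg, Fin.cons_zero]
      linear_combination C (a 0) * C (a 0)⁻¹ * t.1 * hh + t.1 * hi
    · simp only [f, hfXg]
      simp only [g, gX, map_mul, map_neg, Fin.cons_zero, C_1]
      linear_combination t.2.2 * hh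
  have hform : ∀ x, (f x).1 * (f x).2.2 + diagForm (splitCoeff a) (f x).2.1 = diagForm a x := by
    intro x
    have e1 := hx1 x
    have e2 := hx2 x
    simp only [map_mul, map_neg] at e1 e2
    simp only [diagForm, f, splitCoeff, Fin.sum_univ_succ, Fin.cons_zero, Fin.cons_succ, map_mul,
      map_neg, C_1]
    change _ = _ + (C (a 1) * x 1 ^ 2 + (C (a 2) * x 2 ^ 2 + _))
    linear_combination -(fX x ^ 2 + C (a 1) * C (a 2) * fY x ^ 2) * h1 +
      C (a 1) * (C α * fX x + -(C (a 2) * C β) * fY x + x 1) * e1 +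
      C (a 2) * (C β * fX x + C (a 1) * C α * fY x + x 2) * e2
  have hfdeg : ∀ x, (∀ i, (x i).degree < (P : WithBot ℕ)) → (f x).1.degree < (P : WithBot ℕ) ∧
      (∀ i, ((f x).2.1 i).degree < (P : WithBot ℕ)) ∧ (f x).2.2.degree < (P : WithBot ℕ) := by
    intro x hx
    have hX := degree_C_mul_add_C_mul_lt_s19 (-(a 0)⁻¹ * (a 1 * α)) (-(a 0)⁻¹ * (a 2 * β))
      (hx 1) (hx 2)
    exact ⟨degree_C_mul_add_C_mul_lt_s19 _ _ (hx 0) hX,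
      fun i => Fin.cases (degree_C_mul_add_C_mul_lt_s19 _ _ (hx 1) (hx 2)) (fun i => hx _) i,
      degree_C_mul_add_C_mul_lt_s19 _ _ (hx 0) hX⟩
  have hgdeg : ∀ t, t.1.degree < (P : WithBot ℕ) → (∀ i, (t.2.1 i).degree < (P : WithBot ℕ)) →
      t.2.2.degree < (P : WithBot ℕ) → ∀ i, (g t i).degree < (P : WithBot ℕ) := by
    intro t h1 h2 h3 i
    have hX : (gX t).degree < (P : WithBot ℕ) := degree_C_mul_add_C_mul_lt_s19 _ _ h3 h1
    exact Fin.cases (degree_C_mul_add_C_mul_lt_s19 _ _ h3 h1)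
      (fun i => Fin.cases (degree_C_mul_add_C_mul_lt_s19 _ _ hX (h2 0))
        (fun i => Fin.cases (degree_C_mul_add_C_mul_lt_s19 _ _ hX (h2 0)) (fun i => h2 _) i) i) i
  refine Nat.card_congr (Equiv.subtypeEquiv ⟨f, g, hgf, hfg⟩ fun x => ?_)
  change _ ↔ _ ∧ _ ∧ _ ∧ (f x).1 * (f x).2.2 + diagForm (splitCoeff a) (f x).2.1 = 0
  rw [hform]
  constructor
  · rintro ⟨hx, h0⟩
    exact ⟨(hfdeg x hx).1, (hfdeg x hx).2.1, (hfdeg x hx).2.2, h0⟩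
  · rintro ⟨h1, h2, h3, h0⟩
    refine ⟨?_, h0⟩
    have := hgdeg (f x) h1 h2 h3
    rwa [hgf] at this

end Isometry

section GeneratingFunction

theorem mul_eq_of_renewal {A : Type*} [CommRing A] [IsDomain A] {q σ T N R f G H N' : A}
    (hN : (1 - σ * T) * (1 - q ^ 2 * σ * T ^ 2) * N = 1 + (q - 1) * σ * T - q * σ * T ^ 2)
    (hR : (1 - σ * T) * (1 - q * σ * T ^ 2) * R = 1 - σ * T ^ 2)
    (hG : G = (q * σ * T) ^ 2 * R - q * σ * T * (R - 1)) (hH : H = q * σ * T * R)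
    (hf : f = (q - 1) * N + f * G) (hN' : N' = N + f * H)
    (h₁ : 1 - σ * T ≠ 0) (hW : 1 + q * σ * T * R ≠ 0) :
    (1 - q * σ * T) * (1 - q ^ 2 * σ * T ^ 2) * N' =
      1 + (q - 1) * (q * σ) * T - q * σ * T ^ 2 := by
  have hW' : (1 - q ^ 2 * σ * T ^ 2) * N = (1 - q * σ * T ^ 2) * (1 + q * σ * T * R) := by
    apply mul_left_cancel₀ h₁
    linear_combination hN - q * σ * T * hR
  have hf' : (1 - q ^ 2 * σ * T ^ 2) * (1 - q * σ * T) * f = (q - 1) * (1 - q * σ * T ^ 2) := by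
    apply mul_right_cancel₀ hW
    rw [hG] at hf
    linear_combination (1 - q ^ 2 * σ * T ^ 2) * hf + (q - 1) * hW'
  apply mul_left_cancel₀ h₁
  rw [hN', hH]
  linear_combination (1 - q * σ * T) * hN + (1 - σ * T) * q * σ * T * R * hf' +
    (q - 1) * q * σ * T * hR

theorem mk_eq_of_convolution {u v w : ℕ → ℚ} {g : PowerSeries ℚ} (hg : PowerSeries.coeff 0 g = 0)
    (h : ∀ d, u d = v d + ∑ e ∈ Finset.range d, w e * PowerSeries.coeff (d - e) g) :
    PowerSeries.mk u = PowerSeries.mk v + PowerSeries.mk w * g := by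
  ext d
  rw [map_add, PowerSeries.coeff_mul]
  simp only [PowerSeries.coeff_mk]
  rw [Finset.Nat.sum_antidiagonal_eq_sum_range_succ fun i j => w i * PowerSeries.coeff j g,
    Finset.sum_range_succ, Nat.sub_self, hg, mul_zero, add_zero, h]

theorem mk_mul_eq_of_recurrence {s σ : ℚ} {r : ℕ → ℚ} (h0 : r 0 = 1) (h1 : r 1 = σ)
    (h : ∀ j, r (j + 2) = s * r j + (σ - 1) * σ ^ (j + 1)) :
    (1 - PowerSeries.C σ * PowerSeries.X) * (1 - PowerSeries.C s * PowerSeries.X ^ 2) *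
      PowerSeries.mk r = 1 - PowerSeries.C σ * PowerSeries.X ^ 2 := by
  have key : (1 - PowerSeries.C s * PowerSeries.X ^ 2) * PowerSeries.mk r =
      1 + PowerSeries.X +
        PowerSeries.C (σ - 1) * PowerSeries.X * PowerSeries.mk fun j => σ ^ j := by
    ext j
    rcases j with _ | _ | j
    · simp [h0, sub_mul, mul_assoc, pow_two]
    · simp [h1, sub_mul, mul_assoc, PowerSeries.coeff_succ_X_mul, pow_two, PowerSeries.coeff_one,
        PowerSeries.coeff_zero_X_mul]
    · simp [h, sub_mul, mul_assoc, PowerSeries.coeff_succ_X_mul, pow_two, PowerSeries.coeff_one,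
        PowerSeries.coeff_X, PowerSeries.coeff_C_mul]
  have geom : (1 - PowerSeries.C σ * PowerSeries.X) * (PowerSeries.mk fun j => σ ^ j) = 1 := by
    ext j
    rcases j with _ | j
    · simp [sub_mul, mul_assoc]
    · simp [sub_mul, mul_assoc, PowerSeries.coeff_succ_X_mul, PowerSeries.coeff_one, pow_succ']
  rw [mul_assoc, key]
  rw [map_sub, map_one]
  linear_combination (PowerSeries.C σ - 1) * PowerSeries.X * geom

end GeneratingFunction

section Recursion

variable {F : Type} [Field F] [Fintype F] {m : ℕ}

theorem card_ne_zero_rat : (Fintype.card F : ℚ) ≠ 0 := by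
  exact_mod_cast Fintype.card_ne_zero

/-- The generating function of the counts `diagCount b P`. -/
noncomputable def diagSeries (b : Fin m → F) : PowerSeries ℚ :=
  PowerSeries.mk fun P => (diagCount b P : ℚ)

/-- The generating function of `diagCount b` is the rational function
`(1 + (q - 1)xT - xT²) / ((1 - xT)(1 - qxT²))`. -/
def HasDiagSeries (b : Fin m → F) (x : ℚ) : Prop :=
  (1 - PowerSeries.C x * PowerSeries.X) *
      (1 - PowerSeries.C (Fintype.card F * x) * PowerSeries.X ^ 2) * diagSeries b =
    1 + PowerSeries.C ((Fintype.card F - 1) * x) * PowerSeries.X -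
      PowerSeries.C x * PowerSeries.X ^ 2

/-- The generating function of the number of vectors `v` modulo `t ^ j` with
`t ^ j ∣ ∑ bᵢ vᵢ²`. -/
noncomputable def dvdSeries (b : Fin m → F) : PowerSeries ℚ :=
  PowerSeries.mk fun j => (Nat.card (dvdVectors b j j) : ℚ)

theorem HasDiagSeries.coeff_eq {b : Fin m → F} {x : ℚ} (h : HasDiagSeries b x) (P : ℕ) :
    PowerSeries.coeff P (diagSeries b) - x * PowerSeries.coeff P (PowerSeries.X * diagSeries b) -
        Fintype.card F * x * PowerSeries.coeff P (PowerSeries.X * (PowerSeries.X * diagSeries b)) +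
        Fintype.card F * x ^ 2 * PowerSeries.coeff P
          (PowerSeries.X * (PowerSeries.X * (PowerSeries.X * diagSeries b))) =
      PowerSeries.coeff P (1 : PowerSeries ℚ) +
        (Fintype.card F - 1) * x * PowerSeries.coeff P (PowerSeries.X : PowerSeries ℚ) -
        x * PowerSeries.coeff P (PowerSeries.X * PowerSeries.X : PowerSeries ℚ) := by
  rw [HasDiagSeries] at h
  simp only [← PowerSeries.coeff_C_mul, ← map_sub, ← map_add]
  congr 1
  simp only [map_mul, map_pow] at h ⊢
  linear_combination h

theorem HasDiagSeries.diagCount_zero {b : Fin m → F} {x : ℚ} (h : HasDiagSeries b x) :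
    (diagCount b 0 : ℚ) = 1 := by
  simpa [diagSeries] using h.coeff_eq 0

theorem HasDiagSeries.diagCount_one {b : Fin m → F} {x : ℚ} (h : HasDiagSeries b x) :
    (diagCount b 1 : ℚ) = Fintype.card F * x := by
  have h1 := h.coeff_eq (0 + 1)
  simp only [PowerSeries.coeff_succ_X_mul, PowerSeries.coeff_zero_X_mul, PowerSeries.coeff_one,
    PowerSeries.coeff_X, diagSeries, PowerSeries.coeff_mk] at h1
  norm_num [h.diagCount_zero] at h1
  linarith

theorem HasDiagSeries.diagCount_two {b : Fin m → F} {x : ℚ} (h : HasDiagSeries b x) :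
    (diagCount b 2 : ℚ) = Fintype.card F * x ^ 2 + (Fintype.card F - 1) * x := by
  have h1 := h.coeff_eq (0 + 1 + 1)
  simp only [PowerSeries.coeff_succ_X_mul, PowerSeries.coeff_zero_X_mul, PowerSeries.coeff_one,
    PowerSeries.coeff_X, diagSeries, PowerSeries.coeff_mk] at h1
  norm_num [h.diagCount_zero, h.diagCount_one] at h1
  linarith

theorem HasDiagSeries.diagCount_add_three {b : Fin m → F} {x : ℚ} (h : HasDiagSeries b x)
    (P : ℕ) :
    (diagCount b (P + 3) : ℚ) = x * diagCount b (P + 2) + Fintype.card F * x * diagCount b (P + 1) -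
      Fintype.card F * x ^ 2 * diagCount b P := by
  have h1 := h.coeff_eq (P + 1 + 1 + 1)
  simp only [PowerSeries.coeff_succ_X_mul, PowerSeries.coeff_one,
    PowerSeries.coeff_X, diagSeries, PowerSeries.coeff_mk] at h1
  rw [if_neg (by omega), if_neg (by omega), if_neg (by omega)] at h1
  linarith

theorem dvdSeries_identity (h2 : (2 : F) ≠ 0) {b : Fin m → F} (hb : ∀ i, b i ≠ 0) {σ : ℚ}
    (hN : (diagCount b 1 : ℚ) = σ) (hσ : (Fintype.card F : ℚ) ^ (m - 1) = σ) :
    (1 - PowerSeries.C σ * PowerSeries.X) *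
      (1 - PowerSeries.C ((Fintype.card F : ℚ) ^ m) * PowerSeries.X ^ 2) * dvdSeries b =
    1 - PowerSeries.C σ * PowerSeries.X ^ 2 := by
  refine mk_mul_eq_of_recurrence (by rw [card_dvdVectors_zero, Nat.cast_one]) ?_ fun j => ?_
  · have h := card_dvdVectors_succ h2 hb 0
    rw [card_dvdVectors_fiber_zero_zero, hN, pow_zero] at h
    linear_combination h
  · have h := card_dvdVectors_succ h2 hb (j + 1)
    rw [card_dvdVectors_fiber_zero_succ, hN, hσ] at h
    push_cast at h
    linear_combination h

theorem card_lowDegreeVectors_self (b : Fin m → F) (N : ℕ) :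
    Nat.card (lowDegreeVectors b (N + 1) (N + 1)) =
      Fintype.card F ^ m * Nat.card (dvdVectors b N N) := by
  have h := card_dvdVectors_add b N 1
  rw [pow_one] at h
  rw [card_lowDegreeVectors, show N + N + 1 - (N + 1) = N by omega, h, mul_comm]

theorem card_lowDegreeVectors_one_two (b : Fin m → F) :
    Nat.card (lowDegreeVectors b 1 2) = Fintype.card F ^ m := by
  have h := card_dvdVectors_add b 0 1
  rw [pow_one, card_dvdVectors_zero, one_mul] at h
  exact (card_lowDegreeVectors b 0 2).trans h

theorem card_lowDegreeVectors_succ (b : Fin m → F) (N : ℕ) :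
    Nat.card (lowDegreeVectors b (N + 2) (N + 3)) =
      (Fintype.card F ^ m) ^ 2 * Nat.card (dvdVectors b N N) := by
  rw [card_lowDegreeVectors, show N + 1 + (N + 1) + 1 - (N + 3) = N by omega,
    card_dvdVectors_add b N 2, mul_comm]

/-- The generating function of the cardinality of `lowDegreeVectors b k k` for `k ≥ 1`. -/
noncomputable def lowSeries (b : Fin m → F) : PowerSeries ℚ :=
  PowerSeries.C ((Fintype.card F : ℚ) ^ m) * PowerSeries.X * dvdSeries b

/-- The generating function of the difference between the cardinalities of
`lowDegreeVectors b k (k + 1)` and `lowDegreeVectors b k k` for `k ≥ 1`. -/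
noncomputable def lowDiffSeries (b : Fin m → F) : PowerSeries ℚ :=
  (PowerSeries.C ((Fintype.card F : ℚ) ^ m) * PowerSeries.X) ^ 2 * dvdSeries b -
    PowerSeries.C ((Fintype.card F : ℚ) ^ m) * PowerSeries.X * (dvdSeries b - 1)

theorem coeff_lowSeries (b : Fin m → F) {k : ℕ} (hk : 1 ≤ k) :
    PowerSeries.coeff k (lowSeries b) = Nat.card (lowDegreeVectors b k k) := by
  obtain ⟨k, rfl⟩ := Nat.exists_eq_add_of_le' hk
  rw [lowSeries, mul_assoc, PowerSeries.coeff_C_mul, PowerSeries.coeff_succ_X_mul, dvdSeries,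
    PowerSeries.coeff_mk, card_lowDegreeVectors_self]
  push_cast
  rfl

theorem coeff_lowDiffSeries (b : Fin m → F) {k : ℕ} (hk : 1 ≤ k) :
    PowerSeries.coeff k (lowDiffSeries b) =
      Nat.card (lowDegreeVectors b k (k + 1)) - Nat.card (lowDegreeVectors b k k) := by
  obtain ⟨k, rfl⟩ := Nat.exists_eq_add_of_le' hk
  rw [lowDiffSeries, pow_two, mul_assoc, mul_assoc, mul_assoc, mul_assoc, map_sub,
    PowerSeries.coeff_C_mul, PowerSeries.coeff_C_mul, PowerSeries.coeff_succ_X_mul,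
    PowerSeries.coeff_succ_X_mul, PowerSeries.coeff_C_mul, card_lowDegreeVectors_self]
  rcases k with _ | k
  · rw [PowerSeries.coeff_zero_X_mul, card_lowDegreeVectors_one_two, card_dvdVectors_zero, map_sub,
      dvdSeries, PowerSeries.coeff_mk, card_dvdVectors_zero]
    simp
  · rw [PowerSeries.coeff_succ_X_mul, card_lowDegreeVectors_succ]
    simp [dvdSeries, PowerSeries.coeff_one]
    ring

theorem hyperbolicSeries_eq (b : Fin m → F) :
    (PowerSeries.mk fun P => (Nat.card (hyperbolicSolutions b P P) : ℚ)) =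
      PowerSeries.rescale (Fintype.card F : ℚ) (diagSeries b) +
        (PowerSeries.mk fun e => (Nat.card (divisorPairs b e) : ℚ)) * lowSeries b := by
  rw [diagSeries, PowerSeries.rescale_mk]
  refine mk_eq_of_convolution (by simp [lowSeries, mul_assoc]) fun d => ?_
  rw [card_hyperbolicSolutions b le_rfl]
  push_cast
  rw [mul_comm]
  refine congrArg₂ _ rfl (Finset.sum_congr rfl fun e he => ?_)
  rw [coeff_lowSeries b (by have := Finset.mem_range.1 he; omega)]

theorem divisorSeries_eq (b : Fin m → F) :
    (PowerSeries.mk fun e => (Nat.card (divisorPairs b e) : ℚ)) =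
      (PowerSeries.C (Fintype.card F : ℚ) - 1) *
          PowerSeries.rescale (Fintype.card F : ℚ) (diagSeries b) +
        (PowerSeries.mk fun e => (Nat.card (divisorPairs b e) : ℚ)) * lowDiffSeries b := by
  have hv : (PowerSeries.C (Fintype.card F : ℚ) - 1) *
      PowerSeries.rescale (Fintype.card F : ℚ) (diagSeries b) = PowerSeries.mk fun d =>
        ((Fintype.card F : ℚ) - 1) * ((Fintype.card F : ℚ) ^ d * diagCount b d) := by
    ext d
    rw [sub_mul, one_mul, map_sub, PowerSeries.coeff_C_mul, PowerSeries.coeff_rescale, diagSeries,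
      PowerSeries.coeff_mk, PowerSeries.coeff_mk]
    ring
  rw [hv]
  refine mk_eq_of_convolution (by simp [lowDiffSeries, mul_assoc, pow_two]) fun d => ?_
  have h := card_hyperbolicSolutions_succ b d
  rw [card_hyperbolicSolutions b le_rfl, card_hyperbolicSolutions b d.le_succ,
    Nat.succ_eq_add_one] at h
  have h' := congrArg (Nat.cast : ℕ → ℚ) h
  push_cast at h'
  have hsum : ∑ e ∈ Finset.range d, (Nat.card (divisorPairs b e) : ℚ) *
      PowerSeries.coeff (d - e) (lowDiffSeries b) =
      ∑ e ∈ Finset.range d, (Nat.card (divisorPairs b e) : ℚ) *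
        Nat.card (lowDegreeVectors b (d - e) (d + 1 - e)) -
      ∑ e ∈ Finset.range d, (Nat.card (divisorPairs b e) : ℚ) *
        Nat.card (lowDegreeVectors b (d - e) (d - e)) := by
    rw [← Finset.sum_sub_distrib]
    refine Finset.sum_congr rfl fun e he => ?_
    have he' := Finset.mem_range.1 he
    rw [coeff_lowDiffSeries b (by omega), show d + 1 - e = d - e + 1 by omega]
    ring
  rw [hsum]
  linear_combination -h'

theorem rescale_C (r x : ℚ) : PowerSeries.rescale r (PowerSeries.C x) = PowerSeries.C x := by
  ext n
  rcases n with _ | n <;> simp [PowerSeries.coeff_rescale, PowerSeries.coeff_C]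

theorem HasDiagSeries.succ {a : Fin (m + 1 + 1 + 1) → F} (hF : ringChar F ≠ 2)
    (ha : ∀ i, a i ≠ 0) {x : ℚ} (hx : (Fintype.card F : ℚ) ^ 2 * x = (Fintype.card F : ℚ) ^ (m + 1))
    (h : HasDiagSeries (splitCoeff a) x) :
    HasDiagSeries a ((Fintype.card F : ℚ) ^ 2 * x) := by
  have hq := card_ne_zero_rat (F := F)
  have hσ : (Fintype.card F : ℚ) ^ (m + 1 - 1) = Fintype.card F * x := by
    apply mul_left_cancel₀ hq
    rw [Nat.add_sub_cancel, ← pow_succ', ← hx]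
    ring
  have hR := dvdSeries_identity (Ring.two_ne_zero hF) (splitCoeff_ne_zero ha) h.diagCount_one hσ
  have hN := congrArg (PowerSeries.rescale (Fintype.card F : ℚ)) h
  have hN' := hyperbolicSeries_eq (splitCoeff a)
  have hf := divisorSeries_eq (splitCoeff a)
  have hC : PowerSeries.C ((Fintype.card F : ℚ) ^ (m + 1)) =
      PowerSeries.C (Fintype.card F : ℚ) * PowerSeries.C (Fintype.card F * x) := by
    rw [← map_mul, ← hx]
    congr 1
    ring
  have hser : (PowerSeries.mk fun P => (Nat.card (hyperbolicSolutions (splitCoeff a) P P) : ℚ)) =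
      diagSeries a := by
    ext P
    simp only [diagSeries, PowerSeries.coeff_mk]
    rw [diagCount_eq_card_hyperbolicSolutions hF ha]
  rw [hser] at hN'
  rw [hC] at hR
  simp only [map_mul, map_sub, map_add, map_one, map_pow, PowerSeries.rescale_X,
    rescale_C] at hN hR
  have key := mul_eq_of_renewal (q := PowerSeries.C (Fintype.card F : ℚ))
    (σ := PowerSeries.C (Fintype.card F : ℚ) * PowerSeries.C x) (T := PowerSeries.X)
    (by linear_combination hN) (by linear_combination hR)
    (R := dvdSeries (splitCoeff a)) (G := lowDiffSeries (splitCoeff a))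
    (H := lowSeries (splitCoeff a))
    (by rw [lowDiffSeries, hC, map_mul]) (by rw [lowSeries, hC, map_mul]) hf hN'
    (fun h0 => by simpa [mul_assoc] using congrArg (PowerSeries.coeff 0) h0)
    (fun h0 => by simpa [mul_assoc] using congrArg (PowerSeries.coeff 0) h0)
  rw [HasDiagSeries]
  simp only [map_mul, map_sub, map_one, map_pow]
  linear_combination key

theorem hasDiagSeries_fin_one {b : Fin 1 → F} (hb : b 0 ≠ 0) :
    HasDiagSeries b (Fintype.card F : ℚ)⁻¹ := by
  have hq := card_ne_zero_rat (F := F)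
  have hcount : ∀ P, diagCount b P = 1 := by
    intro P
    rw [diagCount, Nat.card_eq_one_iff_unique]
    have h0 : ∀ x : Fin 1 → F[X], ∑ i, C (b i) * x i ^ 2 = 0 → x = 0 := by
      intro x hx
      funext i
      fin_cases i
      simpa [hb] using hx
    exact ⟨⟨fun v w => Subtype.ext ((h0 _ v.2.2).trans (h0 _ w.2.2).symm)⟩,
      ⟨⟨0, fun i => by simp, by simp⟩⟩⟩
  have geom : (1 - PowerSeries.X) * diagSeries b = 1 := by
    rw [diagSeries]
    ext j
    rcases j with _ | j
    · simp [sub_mul, hcount]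
    · simp [sub_mul, hcount, PowerSeries.coeff_succ_X_mul, PowerSeries.coeff_one]
  rw [HasDiagSeries, mul_inv_cancel₀ hq, sub_mul (Fintype.card F : ℚ), one_mul,
    mul_inv_cancel₀ hq]
  simp only [map_one, map_sub]
  linear_combination (1 - PowerSeries.C (Fintype.card F : ℚ)⁻¹ * PowerSeries.X) *
    (1 + PowerSeries.X) * geom

theorem hasDiagSeries_of_odd (hF : ringChar F ≠ 2) (k : ℕ) (a : Fin (2 * k + 1) → F)
    (ha : ∀ i, a i ≠ 0) {x : ℚ}
    (hx : (Fintype.card F : ℚ) ^ 2 * x = (Fintype.card F : ℚ) ^ (2 * k + 1)) :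
    HasDiagSeries a x := by
  have hq := card_ne_zero_rat (F := F)
  induction k generalizing x with
  | zero =>
    have : x = (Fintype.card F : ℚ)⁻¹ := by
      apply mul_left_cancel₀ (pow_ne_zero 2 hq)
      rw [hx, pow_two, mul_assoc, mul_inv_cancel₀ hq]
      ring
    rw [this]
    exact hasDiagSeries_fin_one (ha 0)
  | succ k ih =>
    have hx' : (Fintype.card F : ℚ) ^ 2 * (x / (Fintype.card F : ℚ) ^ 2) =
        (Fintype.card F : ℚ) ^ (2 * k + 1) := by
      apply mul_left_cancel₀ (pow_ne_zero 2 hq)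
      rw [mul_div_cancel₀ _ (pow_ne_zero 2 hq), hx]
      ring
    have h := HasDiagSeries.succ (m := 2 * k) hF ha hx'
      (ih (splitCoeff a) (splitCoeff_ne_zero ha) hx')
    rwa [mul_div_cancel₀ _ (pow_ne_zero 2 hq)] at h

end Recursion

section ClosedForm

variable {F : Type} [Field F] [Fintype F] {m : ℕ}

theorem HasDiagSeries.diagCount_even_odd {b : Fin m → F} {x : ℚ} (h : HasDiagSeries b x) (j : ℕ) :
    (diagCount b (2 * j) : ℚ) * (x - Fintype.card F) =
        (Fintype.card F * x - 1) * x ^ (2 * j) -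
          (Fintype.card F - 1) * (x + 1) * (Fintype.card F * x) ^ j ∧
      (diagCount b (2 * j + 1) : ℚ) * (x - Fintype.card F) =
        (Fintype.card F * x - 1) * x ^ (2 * j + 1) -
          (Fintype.card F - 1) * ((Fintype.card F + 1) * x) * (Fintype.card F * x) ^ j ∧
      (diagCount b (2 * j + 2) : ℚ) * (x - Fintype.card F) =
        (Fintype.card F * x - 1) * x ^ (2 * j + 2) -
          (Fintype.card F - 1) * (x + 1) * (Fintype.card F * x) ^ (j + 1) := by
  induction j with
  | zero =>
    simp only [mul_zero, zero_add]
    rw [h.diagCount_zero, h.diagCount_one, h.diagCount_two]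
    refine ⟨?_, ?_, ?_⟩ <;> ring
  | succ j ih =>
    obtain ⟨h0, h1, h2⟩ := ih
    have e3 := h.diagCount_add_three (2 * j)
    have e4 := h.diagCount_add_three (2 * j + 1)
    have h3 : (diagCount b (2 * j + 3) : ℚ) * (x - Fintype.card F) =
        (Fintype.card F * x - 1) * x ^ (2 * j + 3) -
          (Fintype.card F - 1) * ((Fintype.card F + 1) * x) * (Fintype.card F * x) ^ (j + 1) := by
      rw [e3]
      linear_combination x * h2 + Fintype.card F * x * h1 - Fintype.card F * x ^ 2 * h0
    refine ⟨h2, h3, ?_⟩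
    rw [show 2 * (j + 1) + 2 = 2 * j + 1 + 3 by ring, e4]
    linear_combination x * h3 + Fintype.card F * x * h2 - Fintype.card F * x ^ 2 * h1

end ClosedForm


/-- For `n ≥ 5` odd and `X ⊂ ℙ^{n-1}` the quadric over `𝔽_q` (`q` odd) defined by a
diagonal form, the number of morphisms `ℙ¹ → X` of degree exactly `P ≥ 1` equals
`(q^{n-1}-1)(q^{n-2}-1)/(q^{n-2}(q-1))·q^{P(n-2)}` if `P` is even, and the same main
term minus `(q^{n-1}-1)/q^{(n-1)/2}·q^{((n-1)/2)P}` if `P` is odd. -/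
theorem mor_count_odd (Fq : Type) [Field Fq] [Fintype Fq] (hchar : ringChar Fq ≠ 2)
    (n : ℕ) (hn : 5 ≤ n) (hnodd : Odd n)
    (a : Fin n → Fq) (ha : ∀ i, a i ≠ 0)
    (P : ℕ) (hP : 1 ≤ P) :
    morCount a P =
      if Even P then
        ((Fintype.card Fq : ℚ) ^ (n - 1) - 1) * ((Fintype.card Fq : ℚ) ^ (n - 2) - 1) /
            ((Fintype.card Fq : ℚ) ^ (n - 2) * ((Fintype.card Fq : ℚ) - 1)) *
          (Fintype.card Fq : ℚ) ^ (P * (n - 2))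
      else
        ((Fintype.card Fq : ℚ) ^ (n - 1) - 1) * ((Fintype.card Fq : ℚ) ^ (n - 2) - 1) /
            ((Fintype.card Fq : ℚ) ^ (n - 2) * ((Fintype.card Fq : ℚ) - 1)) *
          (Fintype.card Fq : ℚ) ^ (P * (n - 2)) -
        ((Fintype.card Fq : ℚ) ^ (n - 1) - 1) / (Fintype.card Fq : ℚ) ^ ((n - 1) / 2) *
          (Fintype.card Fq : ℚ) ^ (((n - 1) / 2) * P) := by
  obtain ⟨k, rfl⟩ := hnodd
  have hq1 : (1 : ℚ) < Fintype.card Fq := by exact_mod_cast Fintype.one_lt_card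
  set q := (Fintype.card Fq : ℚ) with hq
  have hq0 : q ≠ 0 := by positivity
  have hx : q ^ 2 * q ^ (2 * k + 1 - 2) = q ^ (2 * k + 1) := by
    rw [← pow_add]
    congr 1
    omega
  have hser := hasDiagSeries_of_odd hchar k a ha hx
  have hy : q ^ (2 * k + 1 - 1) = q * q ^ (2 * k + 1 - 2) := by
    rw [← pow_succ']
    congr 1
    omega
  have hy2 : (q ^ k) ^ 2 = q * q ^ (2 * k + 1 - 2) := by
    rw [← hy, ← pow_mul]
    congr 1
    omega
  have hxq : q ^ (2 * k + 1 - 2) - q ≠ 0 := by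
    have : q ^ 1 < q ^ (2 * k + 1 - 2) := pow_lt_pow_right₀ hq1 (by omega)
    rw [pow_one] at this
    exact (sub_pos.2 this).ne'
  have hx0 : q ^ (2 * k + 1 - 2) ≠ 0 := pow_ne_zero _ hq0
  have hyne : q ^ k ≠ 0 := pow_ne_zero _ hq0
  have hq10 : q - 1 ≠ 0 := (sub_pos.2 hq1).ne'
  rw [show (2 * k + 1 - 1) / 2 = k by omega, mul_comm P, pow_mul, pow_mul q k, hy, morCount, ← hq]
  generalize q ^ (2 * k + 1 - 2) = x at *
  generalize q ^ k = y at *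
  obtain ⟨j, rfl | rfl⟩ := Nat.even_or_odd' P
  · obtain ⟨j, rfl⟩ := Nat.exists_eq_add_of_le' (show 1 ≤ j by omega)
    obtain ⟨-, h1, h2⟩ := hser.diagCount_even_odd j
    obtain ⟨-, h3, -⟩ := hser.diagCount_even_odd (j + 1)
    rw [if_pos (even_two_mul _), show 2 * (j + 1) - 1 = 2 * j + 1 by omega]
    rw [← hq] at h1 h2 h3
    rw [div_mul_eq_mul_div, div_eq_div_iff hq10 (mul_ne_zero hx0 hq10)]
    apply mul_right_cancel₀ hxq
    rw [show 2 * j + 2 = 2 * (j + 1) by ring] at h2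
    linear_combination x * (q - 1) * (h3 - (q + 1) * h2 + q * h1)
  · obtain ⟨h0, h1, h2⟩ := hser.diagCount_even_odd j
    rw [if_neg (by simp), show 2 * j + 1 - 1 = 2 * j by omega,
      show 2 * j + 1 + 1 = 2 * j + 2 by ring]
    rw [← hq] at h0 h1 h2
    rw [show (q * x - 1) / y * y ^ (2 * j + 1) = (q * x - 1) * (q * x) ^ j by
      rw [pow_succ, pow_mul, hy2]
      field_simp]
    rw [div_mul_eq_mul_div, div_sub' (mul_ne_zero hx0 hq10),
      div_eq_div_iff hq10 (mul_ne_zero hx0 hq10)]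
    apply mul_right_cancel₀ hxq
    linear_combination x * (q - 1) * (h2 - (q + 1) * h1 + q * h0)
end
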